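/- If u is a 1-superminimizer in an open set Ω ⊂ X, then the lower approximate limit u^∧ takes values in (−∞,∞] at every point of Ω and u^∧ : Ω → (−∞,∞] is lower semicontinuous. -/

import Mathlib

open MeasureTheory Metric Filter Set
open scoped ENNReal NNReal Topology

noncomputable section

namespace MetricBV

variable {X : Type*} [MetricSpace X] [MeasurableSpace X]

/-- A rectifiable curve, encoded as a Lipschitz map on the interval `[0,1]`
(every rectifiable curve admits such a reparametrization). -/
structure Curve (X : Type*) [MetricSpace X] where
  toFun : ℝ → X
  lipschitz : ∃ K : ℝ≥0, LipschitzOnWith K toFun (Set.Icc 0 1)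

/-- The metric speed of a curve at a point. -/
def speed (γ : ℝ → X) (t : ℝ) : ℝ≥0∞ :=
  Filter.limsup (fun h : ℝ => ENNReal.ofReal (dist (γ (t + h)) (γ t) / |h|)) (𝓝[≠] (0 : ℝ))

/-- The curve integral `∫_γ g ds`. -/
def curveIntegral (g : X → ℝ≥0∞) (γ : Curve X) : ℝ≥0∞ :=
  ∫⁻ t in Set.Icc (0 : ℝ) 1, g (γ.toFun t) * speed γ.toFun t

/-- A curve lies in a set `Ω`. -/
def Curve.In (γ : Curve X) (Ω : Set X) : Prop :=
  ∀ t ∈ Set.Icc (0 : ℝ) 1, γ.toFun t ∈ Ω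

/-- The 1-modulus of a family of curves. -/
def Mod1 (μ : Measure X) (Γ : Set (Curve X)) : ℝ≥0∞ :=
  ⨅ (ρ : X → ℝ≥0∞) (_ : Measurable ρ) (_ : ∀ γ ∈ Γ, 1 ≤ curveIntegral ρ γ),
    ∫⁻ x, ρ x ∂μ

/-- `g` is an upper gradient of `u` in `Ω`: the upper gradient inequality holds
along every curve contained in `Ω`. -/
def IsUpperGradientOn (g : X → ℝ≥0∞) (u : X → ℝ) (Ω : Set X) : Prop :=
  ∀ γ : Curve X, γ.In Ω →
    ENNReal.ofReal |u (γ.toFun 1) - u (γ.toFun 0)| ≤ curveIntegral g γ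

/-- `g` is a 1-weak upper gradient of `u` in `Ω`: the upper gradient inequality holds
along every curve in `Ω` outside a family of zero 1-modulus. -/
def IsWeakUpperGradientOn (μ : Measure X) (g : X → ℝ≥0∞) (u : X → ℝ) (Ω : Set X) : Prop :=
  ∃ Γ : Set (Curve X), Mod1 μ Γ = 0 ∧
    ∀ γ : Curve X, γ ∉ Γ → γ.In Ω →
      ENNReal.ofReal |u (γ.toFun 1) - u (γ.toFun 0)| ≤ curveIntegral g γ

/-- Membership in the Newtonian space `N^{1,1}(X)`. -/
def MemN11 (μ : Measure X) (u : X → ℝ) : Prop :=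
  Integrable u μ ∧ ∃ g : X → ℝ≥0∞, Measurable g ∧
    IsWeakUpperGradientOn μ g u Set.univ ∧ ∫⁻ x, g x ∂μ < ⊤

/-- The 1-capacity `cap₁(A) = inf ‖u‖_{N^{1,1}(X)}` over `u ∈ N^{1,1}(X)` with `u ≥ 1` on `A`. -/
def cap1 (μ : Measure X) (A : Set X) : ℝ≥0∞ :=
  ⨅ (u : X → ℝ) (_ : MemN11 μ u) (_ : ∀ x ∈ A, 1 ≤ u x)
    (g : X → ℝ≥0∞) (_ : Measurable g) (_ : IsWeakUpperGradientOn μ g u Set.univ),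
    (∫⁻ x, ENNReal.ofReal |u x| ∂μ + ∫⁻ x, g x ∂μ)

/-- The variational 1-capacity `cap₁(A,Ω) = inf ∫ g_u dμ` over `u ∈ N^{1,1}(X)` with
`u ≥ 1` on `A` and `u = 0` on `X ∖ Ω`. -/
def vcap1 (μ : Measure X) (A Ω : Set X) : ℝ≥0∞ :=
  ⨅ (u : X → ℝ) (_ : MemN11 μ u) (_ : ∀ x ∈ A, 1 ≤ u x) (_ : ∀ x ∈ Ωᶜ, u x = 0)
    (g : X → ℝ≥0∞) (_ : Measurable g) (_ : IsWeakUpperGradientOn μ g u Set.univ),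
    ∫⁻ x, g x ∂μ

/-- Locally Lipschitz in `Ω`: Lipschitz on every compact subset of `Ω`. -/
def LocLipschitzOn (u : X → ℝ) (Ω : Set X) : Prop :=
  ∀ K : Set X, IsCompact K → K ⊆ Ω → ∃ L : ℝ≥0, LipschitzOnWith L u K

/-- Convergence `v i → u` in `L¹_loc(Ω)`. -/
def TendstoL1Loc (μ : Measure X) (v : ℕ → X → ℝ) (u : X → ℝ) (Ω : Set X) : Prop :=
  ∀ K : Set X, IsCompact K → K ⊆ Ω →
    Filter.Tendsto (fun i => ∫⁻ x in K, ENNReal.ofReal |v i x - u x| ∂μ)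
      Filter.atTop (𝓝 0)

/-- The total variation `‖Du‖(Ω)` of `u` in an open set `Ω`: the infimum of
`liminf ∫_Ω g_i dμ` over sequences of locally Lipschitz functions `v i → u` in `L¹_loc(Ω)`
with `g i` a 1-weak upper gradient of `v i` in `Ω`. -/
def tv (μ : Measure X) (u : X → ℝ) (Ω : Set X) : ℝ≥0∞ :=
  ⨅ (v : ℕ → X → ℝ) (_ : ∀ i, LocLipschitzOn (v i) Ω) (_ : TendstoL1Loc μ v u Ω)
    (g : ℕ → X → ℝ≥0∞) (_ : ∀ i, Measurable (g i))
    (_ : ∀ i, IsWeakUpperGradientOn μ (g i) (v i) Ω),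
    Filter.liminf (fun i => ∫⁻ x in Ω, g i x ∂μ) Filter.atTop

/-- The total variation `‖Du‖(A)` for an arbitrary set `A`. -/
def tvs (μ : Measure X) (u : X → ℝ) (A : Set X) : ℝ≥0∞ :=
  ⨅ (U : Set X) (_ : IsOpen U) (_ : A ⊆ U), tv μ u U

/-- The characteristic function of a set, as a real-valued function. -/
def chi (E : Set X) : X → ℝ := Set.indicator E fun _ => (1 : ℝ)

/-- The perimeter `P(E,Ω) = ‖Dχ_E‖(Ω)` of `E` in an open set `Ω`. -/
def perim (μ : Measure X) (E : Set X) (Ω : Set X) : ℝ≥0∞ := tv μ (chi E) Ω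

/-- `u ∈ BV(Ω)`: `u ∈ L¹(Ω)` and `‖Du‖(Ω) < ∞`. -/
def MemBV (μ : Measure X) (u : X → ℝ) (Ω : Set X) : Prop :=
  IntegrableOn u Ω μ ∧ tv μ u Ω < ⊤

/-- `u ∈ BV_loc(Ω)`. -/
def MemBVloc (μ : Measure X) (u : X → ℝ) (Ω : Set X) : Prop :=
  ∀ K : Set X, IsCompact K → K ⊆ Ω → ∃ U : Set X, IsOpen U ∧ K ⊆ U ∧ U ⊆ Ω ∧ MemBV μ u U

/-- `φ ∈ BV_c(Ω)`: a BV function with compact support in `Ω`. -/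
def MemBVc (μ : Measure X) (φ : X → ℝ) (Ω : Set X) : Prop :=
  MemBV μ φ Ω ∧ IsCompact (tsupport φ) ∧ tsupport φ ⊆ Ω

/-- `u` is a 1-minimizer (function of least gradient) in `Ω`. -/
def IsMinimizer (μ : Measure X) (u : X → ℝ) (Ω : Set X) : Prop :=
  MemBVloc μ u Ω ∧ ∀ φ : X → ℝ, MemBVc μ φ Ω →
    tvs μ u (tsupport φ) ≤ tvs μ (fun y => u y + φ y) (tsupport φ)

/-- `u` is a 1-superminimizer in `Ω`. -/
def IsSuperminimizer (μ : Measure X) (u : X → ℝ) (Ω : Set X) : Prop :=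
  MemBVloc μ u Ω ∧ ∀ φ : X → ℝ, MemBVc μ φ Ω → (∀ x, 0 ≤ φ x) →
    tvs μ u (tsupport φ) ≤ tvs μ (fun y => u y + φ y) (tsupport φ)

/-- `u` is a 1-subminimizer in `Ω`. -/
def IsSubminimizer (μ : Measure X) (u : X → ℝ) (Ω : Set X) : Prop :=
  MemBVloc μ u Ω ∧ ∀ φ : X → ℝ, MemBVc μ φ Ω → (∀ x, φ x ≤ 0) →
    tvs μ u (tsupport φ) ≤ tvs μ (fun y => u y + φ y) (tsupport φ)

/-- The lower approximate limit `u^∧(x)`, with values in `[-∞,∞]`. -/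
def lowerApprox (μ : Measure X) (u : X → ℝ) (x : X) : EReal :=
  sSup ((fun t : ℝ => (t : EReal)) '' {t : ℝ | Filter.Tendsto
    (fun r : ℝ => μ ({y | u y < t} ∩ Metric.ball x r) / μ (Metric.ball x r))
    (𝓝[>] (0 : ℝ)) (𝓝 0)})

/-- The upper approximate limit `u^∨(x)`, with values in `[-∞,∞]`. -/
def upperApprox (μ : Measure X) (u : X → ℝ) (x : X) : EReal :=
  sInf ((fun t : ℝ => (t : EReal)) '' {t : ℝ | Filter.Tendsto
    (fun r : ℝ => μ ({y | t < u y} ∩ Metric.ball x r) / μ (Metric.ball x r))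
    (𝓝[>] (0 : ℝ)) (𝓝 0)})

/-- The upper approximate limit of an extended-real-valued function. -/
def upperApproxE (μ : Measure X) (ψ : X → EReal) (x : X) : EReal :=
  sInf ((fun t : ℝ => (t : EReal)) '' {t : ℝ | Filter.Tendsto
    (fun r : ℝ => μ ({y | (t : EReal) < ψ y} ∩ Metric.ball x r) / μ (Metric.ball x r))
    (𝓝[>] (0 : ℝ)) (𝓝 0)})

/-- The measure-theoretic interior `I_E`. -/
def measInterior (μ : Measure X) (E : Set X) : Set X :=
  {x : X | Filter.Tendsto (fun r : ℝ => μ (Metric.ball x r \ E) / μ (Metric.ball x r))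
    (𝓝[>] (0 : ℝ)) (𝓝 0)}

/-- The measure-theoretic boundary `∂*E`. -/
def measBoundary (μ : Measure X) (E : Set X) : Set X :=
  {x : X | 0 < Filter.limsup (fun r : ℝ => μ (Metric.ball x r ∩ E) / μ (Metric.ball x r))
      (𝓝[>] (0 : ℝ)) ∧
    0 < Filter.limsup (fun r : ℝ => μ (Metric.ball x r \ E) / μ (Metric.ball x r))
      (𝓝[>] (0 : ℝ))}

/-- `A` is 1-thin at `x`. -/
def IsThinAt (μ : Measure X) (A : Set X) (x : X) : Prop :=
  Filter.Tendsto (fun r : ℝ =>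
      ENNReal.ofReal r * vcap1 μ (A ∩ Metric.ball x r) (Metric.ball x (2 * r))
        / μ (Metric.ball x r))
    (𝓝[>] (0 : ℝ)) (𝓝 0)

/-- `U` is 1-finely open. -/
def IsFinelyOpen (μ : Measure X) (U : Set X) : Prop :=
  ∀ x ∈ U, IsThinAt μ Uᶜ x

/-- The class `K_{ψ,f}(Ω)` of admissible functions for the obstacle problem. -/
def MemK (μ : Measure X) (ψ : X → EReal) (f : X → ℝ) (Ω : Set X) (u : X → ℝ) : Prop :=
  MemBVloc μ u Set.univ ∧ (∀ᵐ x ∂μ, x ∈ Ω → ψ x ≤ (u x : EReal)) ∧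
    (∀ᵐ x ∂μ, x ∉ Ω → u x = f x)

/-- `u` is a solution of the `K_{ψ,f}(Ω)`-obstacle problem. -/
def IsObstacleSolution (μ : Measure X) (ψ : X → EReal) (f : X → ℝ) (Ω : Set X)
    (u : X → ℝ) : Prop :=
  MemK μ ψ f Ω u ∧ ∀ v : X → ℝ, MemK μ ψ f Ω v → tv μ u Set.univ ≤ tv μ v Set.univ

/-- The standing assumptions: `(X,d,μ)` is a complete metric space with at least two points,
`μ` is a doubling measure with constant `Cd`, and `X` supports a `(1,1)`-Poincaré inequality
with constants `CP`, `lam`. -/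
structure MMS {X : Type*} [MetricSpace X] [MeasurableSpace X] (μ : Measure X)
    (Cd CP lam : ℝ) : Prop where
  complete : CompleteSpace X
  nontrivial : Nontrivial X
  hCd : 1 ≤ Cd
  hCP : 0 < CP
  hlam : 1 ≤ lam
  doubling : ∀ (x : X) (r : ℝ), 0 < r →
    0 < μ (Metric.ball x (2 * r)) ∧
    μ (Metric.ball x (2 * r)) ≤ ENNReal.ofReal Cd * μ (Metric.ball x r) ∧
    μ (Metric.ball x r) < ⊤
  poincare : ∀ (x : X) (r : ℝ), 0 < r → ∀ u : X → ℝ, MeasureTheory.LocallyIntegrable u μ →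
    ∀ g : X → ℝ≥0∞, Measurable g → IsUpperGradientOn g u Set.univ →
      ∫⁻ y in Metric.ball x r, ENNReal.ofReal |u y - ⨍ z in Metric.ball x r, u z ∂μ| ∂μ ≤
        ENNReal.ofReal (CP * r) * (μ (Metric.ball x r) / μ (Metric.ball x (lam * r))) *
          ∫⁻ y in Metric.ball x (lam * r), g y ∂μ

namespace MMS

variable {μ : Measure X} {Cd CP lam : ℝ}

theorem measure_ball_pos (hX : MMS μ Cd CP lam) (x : X) {r : ℝ} (hr : 0 < r) :
    0 < μ (ball x r) := by
  have h := (hX.doubling x (r / 2) (half_pos hr)).1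
  rwa [mul_div_cancel₀ r two_ne_zero] at h

theorem measure_ball_lt_top (hX : MMS μ Cd CP lam) (x : X) (r : ℝ) : μ (ball x r) < ⊤ :=
  (measure_mono (ball_subset_ball (le_max_left r 1))).trans_lt
    (hX.doubling x (max r 1) (by positivity)).2.2

theorem isLocallyFiniteMeasure (hX : MMS μ Cd CP lam) : IsLocallyFiniteMeasure μ :=
  ⟨fun x => ⟨ball x 1, ball_mem_nhds x one_pos, hX.measure_ball_lt_top x 1⟩⟩

theorem measure_ball_two_pow_mul_le (hX : MMS μ Cd CP lam) (x : X) {r : ℝ} (hr : 0 < r) (n : ℕ) :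
    μ (ball x (2 ^ n * r)) ≤ ENNReal.ofReal Cd ^ n * μ (ball x r) := by
  induction n with
  | zero => simp
  | succ n ih =>
    calc μ (ball x (2 ^ (n + 1) * r)) = μ (ball x (2 * (2 ^ n * r))) := by ring_nf
      _ ≤ ENNReal.ofReal Cd * μ (ball x (2 ^ n * r)) :=
        (hX.doubling x (2 ^ n * r) (by positivity)).2.1
      _ ≤ ENNReal.ofReal Cd * (ENNReal.ofReal Cd ^ n * μ (ball x r)) := by gcongr
      _ = _ := by ring

/-- A separated set in a ball of comparable radius has boundedly many points. -/
theorem card_le_of_separated [OpensMeasurableSpace X] (hX : MMS μ Cd CP lam) {M : ℝ} (hM : 0 ≤ M)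
    {n : ℕ} (hn : 2 * (2 * M + 1) ≤ 2 ^ n) {r : ℝ} (hr : 0 < r) (z : X) (F : Finset X)
    (hF : ∀ y ∈ F, dist y z ≤ M * r)
    (hsep : (F : Set X).Pairwise fun a b => r ≤ dist a b) :
    (F.card : ℝ≥0∞) ≤ ENNReal.ofReal Cd ^ n := by
  set B := ball z ((M + 1) * r)
  have hBpos : 0 < μ B := hX.measure_ball_pos z (by positivity)
  have hBtop : μ B < ⊤ := hX.measure_ball_lt_top z _
  have hdisj : (F : Set X).PairwiseDisjoint fun y => ball y (r / 2) := by
    intro a ha b hb hab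
    exact ball_disjoint_ball (by linarith [hsep ha hb hab])
  have hsub : (⋃ y ∈ F, ball y (r / 2)) ⊆ B := by
    refine iUnion₂_subset fun y hy => ball_subset_ball' ?_
    linarith [hF y hy]
  have key : (F.card : ℝ≥0∞) * μ B ≤ ENNReal.ofReal Cd ^ n * μ B := by
    calc (F.card : ℝ≥0∞) * μ B = ∑ y ∈ F, μ B := by simp
      _ ≤ ∑ y ∈ F, ENNReal.ofReal Cd ^ n * μ (ball y (r / 2)) := by
        refine Finset.sum_le_sum fun y hy => ?_
        refine (measure_mono (ball_subset_ball' ?_)).trans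
          (hX.measure_ball_two_pow_mul_le y (half_pos hr) n)
        have := hF y hy
        rw [dist_comm] at this
        nlinarith
      _ = ENNReal.ofReal Cd ^ n * ∑ y ∈ F, μ (ball y (r / 2)) := by rw [Finset.mul_sum]
      _ = ENNReal.ofReal Cd ^ n * μ (⋃ y ∈ F, ball y (r / 2)) := by
        rw [measure_biUnion_finset hdisj fun _ _ => measurableSet_ball]
      _ ≤ _ := by gcongr
  exact (ENNReal.mul_le_mul_iff_left hBpos.ne' hBtop.ne).1 key

/-- Bounded sets have finite maximal separated subsets. -/
theorem exists_net [OpensMeasurableSpace X] (hX : MMS μ Cd CP lam) (x : X) (s : ℝ) {r : ℝ}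
    (hr : 0 < r) :
    ∃ F : Finset X, (∀ y ∈ F, y ∈ closedBall x s) ∧
      ((F : Set X).Pairwise fun a b => r ≤ dist a b) ∧ closedBall x s ⊆ ⋃ y ∈ F, ball y r := by
  classical
  set M := max s 0 / r
  have hM : 0 ≤ M := by positivity
  obtain ⟨n, hn⟩ := pow_unbounded_of_one_lt (2 * (2 * M + 1)) (one_lt_two : (1 : ℝ) < 2)
  obtain ⟨N, hN⟩ := ENNReal.exists_nat_gt
    (ENNReal.pow_ne_top ENNReal.ofReal_ne_top : ENNReal.ofReal Cd ^ n ≠ ⊤)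
  let P : ℕ → Prop := fun k => ∃ F : Finset X, (∀ y ∈ F, y ∈ closedBall x s) ∧
      ((F : Set X).Pairwise fun a b => r ≤ dist a b) ∧ F.card = k
  have hP0 : P 0 := ⟨∅, by simp, by simp, by simp⟩
  have hbound : ∀ k, P k → k ≤ N := by
    rintro k ⟨F, hF, hsep, rfl⟩
    have := hX.card_le_of_separated hM hn.le hr x F (fun y hy => by
      have h1 : M * r = max s 0 := div_mul_cancel₀ _ hr.ne'
      rw [h1]; exact (mem_closedBall.1 (hF y hy)).trans (le_max_left _ _)) hsep
    exact_mod_cast (this.trans_lt hN).le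
  obtain ⟨F, hF, hsep, hcard⟩ : P (Nat.findGreatest P N) :=
    Nat.findGreatest_spec (P := P) (Nat.zero_le N) hP0
  refine ⟨F, hF, hsep, fun z hz => ?_⟩
  by_contra hcon
  simp only [mem_iUnion, mem_ball, not_exists, not_lt] at hcon
  have hzF : z ∉ F := fun h => by simpa using (hcon z h).trans_lt' hr
  have hP : P (F.card + 1) := by
    refine ⟨insert z F, ?_, ?_, Finset.card_insert_of_notMem hzF⟩
    · intro y hy
      rcases Finset.mem_insert.1 hy with rfl | h
      exacts [hz, hF y h]
    · rw [Finset.coe_insert]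
      refine hsep.insert fun b hb _ => ⟨hcon b hb, ?_⟩
      rw [dist_comm]; exact hcon b hb
  have := Nat.le_findGreatest (hbound _ hP) hP
  omega

theorem properSpace [OpensMeasurableSpace X] (hX : MMS μ Cd CP lam) : ProperSpace X := by
  have := hX.complete
  refine ⟨fun x s => TotallyBounded.isCompact_of_isClosed ?_ isClosed_closedBall⟩
  refine Metric.totallyBounded_iff.2 fun ε hε => ?_
  obtain ⟨F, -, -, hF⟩ := hX.exists_net x s hε
  exact ⟨F, F.finite_toSet, by simpa using hF⟩

/-- The dilated balls around a separated set have bounded overlap. -/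
theorem sum_indicator_ball_le [OpensMeasurableSpace X] (hX : MMS μ Cd CP lam) {n : ℕ}
    (hn : 2 * (2 * lam + 1) ≤ 2 ^ n) {r : ℝ} (hr : 0 < r) (F : Finset X)
    (hsep : (F : Set X).Pairwise fun a b => r ≤ dist a b) (g : X → ℝ≥0∞) (z : X) :
    ∑ y ∈ F, (ball y (lam * r)).indicator g z ≤ ENNReal.ofReal Cd ^ n * g z := by
  classical
  have hlam := hX.hlam
  calc ∑ y ∈ F, (ball y (lam * r)).indicator g z
      = ∑ y ∈ F with z ∈ ball y (lam * r), g z := by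
        rw [Finset.sum_filter]; rfl
    _ = ((F.filter fun y => z ∈ ball y (lam * r)).card : ℝ≥0∞) * g z := by simp
    _ ≤ ENNReal.ofReal Cd ^ n * g z := by
      gcongr
      refine hX.card_le_of_separated (by linarith) hn hr z _ (fun y hy => ?_)
        (hsep.mono fun y hy => (Finset.mem_filter.1 hy).1)
      have := (Finset.mem_filter.1 hy).2
      rw [mem_ball, dist_comm] at this
      exact this.le

end MMS

set_option linter.unusedSectionVars false

section Calculus

theorem abs_deriv_le_of_eventually {F I : ℝ → ℝ} {F' I' t : ℝ} (hF : HasDerivAt F F' t)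
    (hI : HasDerivAt I I' t) (h : ∀ᶠ s in 𝓝 t, |F s - F t| ≤ |I s - I t|) : |F'| ≤ |I'| := by
  rw [hasDerivAt_iff_tendsto_slope] at hF hI
  refine le_of_tendsto_of_tendsto hF.abs hI.abs ?_
  filter_upwards [h.filter_mono nhdsWithin_le_nhds] with s hs
  simp only [slope, vsub_eq_sub, smul_eq_mul, abs_mul]
  gcongr

/-- A function whose increments are controlled by the integral of `G` has its derivative
controlled by `G`. -/
theorem ae_abs_deriv_le_of_increments {F : ℝ → ℝ} {G : ℝ → ℝ≥0∞} {a b : ℝ}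
    (hG : ∫⁻ t in Icc a b, G t < ⊤)
    (h : ∀ c d, a ≤ c → c ≤ d → d ≤ b → ENNReal.ofReal |F d - F c| ≤ ∫⁻ t in Icc c d, G t) :
    ∀ᵐ t, t ∈ Ioo a b → ENNReal.ofReal |deriv F t| ≤ G t := by
  rcases lt_or_ge b a with hab | hab
  · simp [Ioo_eq_empty (not_lt.2 hab.le)]
  obtain ⟨g, hgm, hgG, hgint⟩ := exists_measurable_le_setLIntegral_eq_of_integrable hG.ne
  have hgfin : ∫⁻ t in Icc a b, g t ≠ ⊤ := ((lintegral_mono hgG).trans_lt hG).ne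
  have hI : IntegrableOn (fun t => (g t).toReal) (Icc a b) :=
    integrable_toReal_of_lintegral_ne_top hgm.aemeasurable hgfin
  have hII : IntervalIntegrable (fun t => (g t).toReal) volume a b :=
    (intervalIntegrable_iff_integrableOn_Ioc_of_le hab).2 (hI.mono_set Ioc_subset_Icc_self)
  have hfin : ∀ᵐ t, t ∈ Icc a b → g t < ⊤ :=
    (ae_restrict_iff' measurableSet_Icc).1 (ae_lt_top hgm hgfin)
  have hinc : ∀ c d, a ≤ c → c ≤ d → d ≤ b → |F d - F c| ≤ ∫ t in c..d, (g t).toReal := by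
    intro c d hc hcd hd
    have hsub : Icc c d ⊆ Icc a b := Icc_subset_Icc hc hd
    have h1 := h c d hc hcd hd
    have h2 := hgint (Icc c d) measurableSet_Icc
    rw [Measure.restrict_restrict measurableSet_Icc, inter_eq_left.2 hsub] at h2
    rw [h2] at h1
    have h3 : ∫⁻ t in Icc c d, g t ≠ ⊤ := ((lintegral_mono_set hsub).trans_lt hgfin.lt_top).ne
    rw [intervalIntegral.integral_of_le hcd, ← integral_Icc_eq_integral_Ioc,
      integral_toReal hgm.aemeasurable (ae_lt_top hgm h3)]
    exact (ENNReal.ofReal_le_iff_le_toReal h3).1 h1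
  filter_upwards [hII.ae_hasDerivAt_integral] with t ht hmem
  have htI : t ∈ Icc a b := Ioo_subset_Icc_self hmem
  rw [← uIcc_of_le hab] at htI
  have hd := ht htI a (by simp)
  refine le_trans ?_ (hgG t)
  by_cases hF : DifferentiableAt ℝ F t
  swap
  · simp [deriv_zero_of_not_differentiableAt hF]
  have : |deriv F t| ≤ |(g t).toReal| := by
    refine abs_deriv_le_of_eventually hF.hasDerivAt hd ?_
    filter_upwards [Ioo_mem_nhds hmem.1 hmem.2] with s hs
    have hint : ∀ x ∈ Ioo a b, IntervalIntegrable (fun t => (g t).toReal) volume a x :=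
      fun x hx => (intervalIntegrable_iff_integrableOn_Ioc_of_le hx.1.le).2
        (hI.mono_set (Ioc_subset_Icc_self.trans (Icc_subset_Icc le_rfl hx.2.le)))
    rw [intervalIntegral.integral_interval_sub_left (hint s hs) (hint t hmem)]
    rcases le_total t s with hts | hst
    · exact (hinc t s hmem.1.le hts hs.2.le).trans (le_abs_self _)
    · rw [abs_sub_comm, intervalIntegral.integral_symm, abs_neg]
      exact (hinc s t hs.1.le hst hmem.2.le).trans (le_abs_self _)
  rw [abs_of_nonneg ENNReal.toReal_nonneg] at this
  exact (ENNReal.ofReal_le_ofReal this).trans ENNReal.ofReal_toReal_le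

/-- The increment of a Lipschitz function is controlled by the integral of its derivative. -/
theorem ofReal_abs_sub_le_lintegral_deriv {F : ℝ → ℝ} {K : ℝ≥0} {G : ℝ → ℝ≥0∞}
    (hF : LipschitzOnWith K F (Icc 0 1))
    (h : ∀ᵐ t, t ∈ Ioo (0 : ℝ) 1 → ENNReal.ofReal |deriv F t| ≤ G t) :
    ENNReal.ofReal |F 1 - F 0| ≤ ∫⁻ t in Icc (0 : ℝ) 1, G t := by
  have hac : AbsolutelyContinuousOnInterval F 0 1 := by
    refine LipschitzOnWith.absolutelyContinuousOnInterval (K := K) ?_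
    rwa [uIcc_of_le zero_le_one]
  rw [← hac.integral_deriv_eq_sub, intervalIntegral.integral_of_le zero_le_one,
    integral_Ioc_eq_integral_Ioo, ← Real.norm_eq_abs]
  calc ENNReal.ofReal ‖∫ t in Ioo 0 1, deriv F t‖
      ≤ ∫⁻ t in Ioo 0 1, ENNReal.ofReal ‖deriv F t‖ := by
        rw [ofReal_norm]
        refine (enorm_integral_le_lintegral_enorm _).trans (le_of_eq ?_)
        simp_rw [ofReal_norm]
    _ ≤ ∫⁻ t in Ioo 0 1, G t :=
        lintegral_mono_ae ((ae_restrict_iff' measurableSet_Ioo).2 h)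
    _ ≤ _ := lintegral_mono_set Ioo_subset_Icc_self

end Calculus

section Curves

/-- The restriction of a curve to `[a,b] ⊆ [0,1]`, reparametrized by `[0,1]`. -/
def Curve.sub (γ : Curve X) (a b : ℝ) (ha : 0 ≤ a) (hab : a ≤ b) (hb : b ≤ 1) : Curve X where
  toFun t := γ.toFun (a + (b - a) * t)
  lipschitz := by
    obtain ⟨K, hK⟩ := γ.lipschitz
    refine ⟨K * (b - a).toNNReal, hK.comp (g := γ.toFun) (f := fun t => a + (b - a) * t)
      (LipschitzWith.lipschitzOnWith (LipschitzWith.of_dist_le_mul fun s t => ?_)) ?_⟩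
    · rw [Real.coe_toNNReal _ (sub_nonneg.2 hab), Real.dist_eq, Real.dist_eq,
        ← abs_of_nonneg (sub_nonneg.2 hab), ← abs_mul, abs_of_nonneg (sub_nonneg.2 hab)]
      ring_nf; rfl
    · rintro t ⟨h0, h1⟩
      constructor <;> dsimp only <;> nlinarith

theorem speed_comp_affine_le (γ : ℝ → X) (a : ℝ) {c : ℝ} (hc : 0 < c) (t : ℝ) :
    speed (fun s => γ (a + c * s)) t ≤ ENNReal.ofReal c * speed γ (a + c * t) := by
  unfold speed
  rw [← ENNReal.limsup_const_mul_of_ne_top ENNReal.ofReal_ne_top]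
  have htend : Tendsto (fun h : ℝ => c * h) (𝓝[≠] 0) (𝓝[≠] 0) := by
    refine tendsto_nhdsWithin_of_tendsto_nhds_of_eventually_within _ ?_ ?_
    · have : Tendsto (fun h : ℝ => c * h) (𝓝 0) (𝓝 (c * 0)) := tendsto_id.const_mul c
      rw [mul_zero] at this
      exact this.mono_left nhdsWithin_le_nhds
    · filter_upwards [self_mem_nhdsWithin] with h hh
      exact mul_ne_zero hc.ne' hh
  have heq : (fun h : ℝ => ENNReal.ofReal (dist (γ (a + c * (t + h))) (γ (a + c * t)) / |h|)) =
      (fun k : ℝ => ENNReal.ofReal c *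
        ENNReal.ofReal (dist (γ (a + c * t + k)) (γ (a + c * t)) / |k|)) ∘ fun h => c * h := by
    ext h
    simp only [Function.comp]
    rw [← ENNReal.ofReal_mul hc.le, abs_mul, abs_of_pos hc]
    congr 1
    rw [show a + c * (t + h) = a + c * t + c * h by ring]
    field_simp
  rw [heq, Filter.limsup_comp]
  exact limsup_le_limsup_of_le htend

theorem curveIntegral_sub_le (g : X → ℝ≥0∞) (γ : Curve X) {a b : ℝ} (ha : 0 ≤ a) (hab : a < b)
    (hb : b ≤ 1) :
    curveIntegral g (γ.sub a b ha hab.le hb) ≤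
      ∫⁻ t in Icc a b, g (γ.toFun t) * speed γ.toFun t := by
  have hc : 0 < b - a := sub_pos.2 hab
  have himg : (fun t : ℝ => a + (b - a) * t) '' Icc 0 1 = Icc a b := by
    have : (fun t : ℝ => a + (b - a) * t) = fun t => (b - a) * t + a := by ext; ring
    rw [this, image_affine_Icc' hc]
    congr 1 <;> ring
  rw [← himg, lintegral_image_eq_lintegral_abs_deriv_mul (f' := fun _ => b - a) measurableSet_Icc
    (fun t _ => by
      simpa using (((hasDerivAt_id t).const_mul (b - a)).const_add a).hasDerivWithinAt)
    (fun s _ t _ hst => by simpa [hc.ne'] using hst)]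
  refine lintegral_mono fun t => ?_
  rw [abs_of_pos hc]
  calc g (γ.toFun (a + (b - a) * t)) * speed (fun s => γ.toFun (a + (b - a) * s)) t
      ≤ g (γ.toFun (a + (b - a) * t)) *
          (ENNReal.ofReal (b - a) * speed γ.toFun (a + (b - a) * t)) := by
        gcongr
        exact speed_comp_affine_le γ.toFun a hc t
    _ = _ := by ring

theorem ofReal_abs_deriv_comp_le {η : X → ℝ} {L : ℝ≥0} (hη : LipschitzWith L η) (γ : ℝ → X)
    (t : ℝ) : ENNReal.ofReal |deriv (fun s => η (γ s)) t| ≤ L * speed γ t := by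
  by_cases hd : DifferentiableAt ℝ (fun s => η (γ s)) t
  swap
  · simp [deriv_zero_of_not_differentiableAt hd]
  have h1 := (ENNReal.tendsto_ofReal hd.hasDerivAt.tendsto_slope_zero.abs).limsup_eq
  rw [← h1, speed, ← ENNReal.limsup_const_mul_of_ne_top ENNReal.coe_ne_top]
  refine limsup_le_limsup ?_
  filter_upwards [self_mem_nhdsWithin] with h hh
  rw [← ENNReal.ofReal_coe_nnreal, ← ENNReal.ofReal_mul L.coe_nonneg]
  refine ENNReal.ofReal_le_ofReal ?_
  rw [smul_eq_mul, abs_mul, abs_inv, ← Real.dist_eq, inv_mul_eq_div, ← mul_div_assoc]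
  have := hη.dist_le_mul (γ (t + h)) (γ t)
  gcongr

theorem exists_lipschitzOnWith_comp {Ω : Set X} {v : X → ℝ} (hv : LocLipschitzOn v Ω)
    {γ : Curve X} (hγ : γ.In Ω) : ∃ K : ℝ≥0, LipschitzOnWith K (fun t => v (γ.toFun t)) (Icc 0 1) := by
  obtain ⟨K, hK⟩ := γ.lipschitz
  obtain ⟨L, hL⟩ := hv (γ.toFun '' Icc 0 1) (isCompact_Icc.image_of_continuousOn hK.continuousOn)
    (image_subset_iff.2 hγ)
  exact ⟨L * K, hL.comp hK (mapsTo_image _ _)⟩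

theorem Curve.continuousAt (γ : Curve X) {t : ℝ} (ht : t ∈ Ioo (0 : ℝ) 1) :
    ContinuousAt γ.toFun t := by
  obtain ⟨K, hK⟩ := γ.lipschitz
  exact (hK.continuousOn t (Ioo_subset_Icc_self ht)).continuousAt (Icc_mem_nhds ht.1 ht.2)

end Curves

section Modulus

variable {μ : Measure X} {Γ : Set (Curve X)}

theorem curveIntegral_mono {g₁ g₂ : X → ℝ≥0∞} (h : ∀ x, g₁ x ≤ g₂ x) (γ : Curve X) :
    curveIntegral g₁ γ ≤ curveIntegral g₂ γ :=
  lintegral_mono fun t => mul_le_mul_left (h (γ.toFun t)) _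

theorem mod1_le_lintegral {ρ : X → ℝ≥0∞} (hρ : Measurable ρ)
    (h : ∀ γ ∈ Γ, 1 ≤ curveIntegral ρ γ) : Mod1 μ Γ ≤ ∫⁻ x, ρ x ∂μ :=
  iInf₂_le_of_le ρ hρ (iInf_le _ h)

theorem exists_admissible_of_mod1_eq_zero (h : Mod1 μ Γ = 0) {ε : ℝ≥0∞} (hε : ε ≠ 0) :
    ∃ ρ : X → ℝ≥0∞, Measurable ρ ∧ (∀ γ ∈ Γ, 1 ≤ curveIntegral ρ γ) ∧ ∫⁻ x, ρ x ∂μ < ε := by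
  have hlt : Mod1 μ Γ < ε := h ▸ pos_iff_ne_zero.2 hε
  simpa only [Mod1, iInf_lt_iff, exists_prop] using hlt

theorem mod1_union_eq_zero {Γ' : Set (Curve X)} (h : Mod1 μ Γ = 0) (h' : Mod1 μ Γ' = 0) :
    Mod1 μ (Γ ∪ Γ') = 0 := by
  refine le_antisymm (le_of_forall_gt_imp_ge_of_dense fun ε hε => ?_) (zero_le)
  obtain ⟨ρ, hρ, hadm, hint⟩ := exists_admissible_of_mod1_eq_zero h (ENNReal.half_pos hε.ne').ne'
  obtain ⟨ρ', hρ', hadm', hint'⟩ :=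
    exists_admissible_of_mod1_eq_zero h' (ENNReal.half_pos hε.ne').ne'
  refine (mod1_le_lintegral (hρ.add hρ') ?_).trans ?_
  · rintro γ (hγ | hγ)
    · exact (hadm γ hγ).trans (curveIntegral_mono (fun x => le_self_add) γ)
    · exact (hadm' γ hγ).trans (curveIntegral_mono (fun x => le_add_self) γ)
  · simp only [Pi.add_apply]
    rw [lintegral_add_left hρ, ← ENNReal.add_halves ε]
    exact add_le_add hint.le hint'.le

theorem mod1_curveIntegral_eq_top {g : X → ℝ≥0∞} (hg : Measurable g) (hfin : ∫⁻ x, g x ∂μ < ⊤) :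
    Mod1 μ {γ : Curve X | curveIntegral g γ = ⊤} = 0 := by
  have hle : ∀ n : ℕ, Mod1 μ {γ : Curve X | curveIntegral g γ = ⊤} ≤
      ((n + 1 : ℕ) : ℝ≥0∞)⁻¹ * ∫⁻ x, g x ∂μ := by
    intro n
    rw [← lintegral_const_mul _ hg]
    refine mod1_le_lintegral (hg.const_mul _) fun γ hγ => ?_
    have hc : ((n + 1 : ℕ) : ℝ≥0∞)⁻¹ ≠ ⊤ := by simp
    have : curveIntegral (fun x => ((n + 1 : ℕ) : ℝ≥0∞)⁻¹ * g x) γ =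
        ((n + 1 : ℕ) : ℝ≥0∞)⁻¹ * curveIntegral g γ := by
      simp only [curveIntegral, mul_assoc]
      rw [lintegral_const_mul' _ _ hc]
    rw [this, hγ, ENNReal.mul_top (ENNReal.inv_ne_zero.2 (ENNReal.natCast_ne_top _))]
    exact le_top
  have ht : Tendsto (fun n : ℕ => ((n + 1 : ℕ) : ℝ≥0∞)⁻¹ * ∫⁻ x, g x ∂μ) atTop (𝓝 0) := by
    have := ENNReal.Tendsto.mul_const (b := ∫⁻ x, g x ∂μ)
      ((tendsto_add_atTop_iff_nat 1).2 ENNReal.tendsto_inv_nat_nhds_zero) (Or.inr hfin.ne)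
    simpa using this
  exact le_antisymm (ge_of_tendsto' ht hle) (zero_le)

theorem mod1_subcurves_eq_zero (h : Mod1 μ Γ = 0) :
    Mod1 μ {γ : Curve X | ∃ (a b : ℝ) (ha : 0 ≤ a) (hab : a < b) (hb : b ≤ 1),
      γ.sub a b ha hab.le hb ∈ Γ} = 0 := by
  refine le_antisymm (le_of_forall_gt_imp_ge_of_dense fun ε hε => ?_) (zero_le)
  obtain ⟨ρ, hρ, hadm, hint⟩ := exists_admissible_of_mod1_eq_zero h hε.ne'
  refine (mod1_le_lintegral hρ ?_).trans hint.le
  rintro γ ⟨a, b, ha, hab, hb, hγ⟩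
  exact ((hadm _ hγ).trans (curveIntegral_sub_le ρ γ ha hab hb)).trans
    (lintegral_mono_set (Icc_subset_Icc ha hb))

/-- A curve family of zero modulus carries a density with small integral whose integral
along each curve of the family is infinite. -/
theorem exists_curveIntegral_eq_top (h : Mod1 μ Γ = 0) {ε : ℝ≥0∞} (hε : ε ≠ 0) :
    ∃ ρ : X → ℝ≥0∞, Measurable ρ ∧ (∀ γ ∈ Γ, curveIntegral ρ γ = ⊤) ∧ ∫⁻ x, ρ x ∂μ ≤ ε := by
  obtain ⟨δ, hδ, hδε⟩ := ENNReal.exists_pos_sum_of_countable hε ℕ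
  choose ρ hρ hadm hint using fun n : ℕ =>
    exists_admissible_of_mod1_eq_zero h (ENNReal.coe_ne_zero.2 (hδ n).ne')
  refine ⟨fun x => ∑' n, ρ n x, Measurable.tsum hρ, fun γ hγ => ?_, ?_⟩
  · have hN : ∀ N : ℕ, (N : ℝ≥0∞) ≤ curveIntegral (fun x => ∑ n ∈ Finset.range N, ρ n x) γ := by
      intro N
      induction N with
      | zero => simp
      | succ N ih =>
        calc ((N + 1 : ℕ) : ℝ≥0∞) = N + 1 := by push_cast; rfl
          _ ≤ curveIntegral (fun x => ∑ n ∈ Finset.range N, ρ n x) γ + curveIntegral (ρ N) γ :=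
            add_le_add ih (hadm N γ hγ)
          _ ≤ _ := by
            refine (le_lintegral_add _ _).trans (le_of_eq ?_)
            simp only [curveIntegral, Finset.sum_range_succ, add_mul]
    refine ENNReal.eq_top_of_forall_nnreal_le fun r => ?_
    obtain ⟨N, hr⟩ := exists_nat_ge r
    calc (r : ℝ≥0∞) ≤ N := by exact_mod_cast hr
      _ ≤ _ := (hN N).trans (curveIntegral_mono (fun x => ENNReal.sum_le_tsum _) γ)
  · rw [lintegral_tsum fun n => (hρ n).aemeasurable]
    exact (ENNReal.tsum_le_tsum fun n => (hint n).le).trans hδε.le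

end Modulus

section Gradients

variable {μ : Measure X} {g : X → ℝ≥0∞} {v : X → ℝ} {Ω : Set X}

theorem IsWeakUpperGradientOn.exists_isUpperGradientOn (h : IsWeakUpperGradientOn μ g v Ω)
    {ε : ℝ≥0∞} (hε : ε ≠ 0) : ∃ ρ : X → ℝ≥0∞, Measurable ρ ∧ ∫⁻ x, ρ x ∂μ ≤ ε ∧
      IsUpperGradientOn (fun x => g x + ρ x) v Ω := by
  obtain ⟨Γ, hΓ, hug⟩ := h
  obtain ⟨ρ, hρ, htop, hint⟩ := exists_curveIntegral_eq_top hΓ hε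
  refine ⟨ρ, hρ, hint, fun γ hγ => ?_⟩
  by_cases hmem : γ ∈ Γ
  · have := (htop γ hmem).symm.le.trans
      (curveIntegral_mono (g₂ := fun x => g x + ρ x) (fun x => le_add_self) γ)
    exact le_top.trans this
  · exact (hug γ hmem hγ).trans (curveIntegral_mono (fun x => le_self_add) γ)

theorem exists_rat_Icc_subset (hΩ : IsOpen Ω) {γ : Curve X} {t : ℝ} (hmem : t ∈ Ioo (0 : ℝ) 1)
    (htΩ : γ.toFun t ∈ Ω) : ∃ p q : ℚ, 0 ≤ (p : ℝ) ∧ (q : ℝ) ≤ 1 ∧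
      (∀ s ∈ Icc (p : ℝ) q, γ.toFun s ∈ Ω) ∧ t ∈ Ioo (p : ℝ) q := by
  have hnhds : γ.toFun ⁻¹' Ω ∩ Ioo 0 1 ∈ 𝓝 t :=
    inter_mem ((γ.continuousAt hmem).preimage_mem_nhds (hΩ.mem_nhds htΩ))
      (Ioo_mem_nhds hmem.1 hmem.2)
  obtain ⟨ε, hε, hball⟩ := Metric.mem_nhds_iff.1 hnhds
  obtain ⟨p, hp1, hp2⟩ := exists_rat_btwn (sub_lt_self t hε)
  obtain ⟨q, hq1, hq2⟩ := exists_rat_btwn (lt_add_of_pos_right t hε)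
  have hmemball : ∀ s ∈ Icc (p : ℝ) q, s ∈ γ.toFun ⁻¹' Ω ∩ Ioo 0 1 := fun s hs => hball <| by
    rw [mem_ball, Real.dist_eq, abs_lt]
    constructor <;> linarith [hs.1, hs.2]
  have hpq : (p : ℝ) ≤ q := (hp2.trans hq1).le
  exact ⟨p, q, (hmemball p (left_mem_Icc.2 hpq)).2.1.le, (hmemball q (right_mem_Icc.2 hpq)).2.2.le,
    fun s hs => (hmemball s hs).1, hp2, hq1⟩

/-- Infinitesimal form of the 1-weak upper gradient inequality: along almost every curve, `g`
dominates the derivative of `v` at almost every parameter at which the curve is in `Ω`. -/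
def IsDerivGradientOn (μ : Measure X) (g : X → ℝ≥0∞) (v : X → ℝ) (Ω : Set X) : Prop :=
  ∃ Γ : Set (Curve X), Mod1 μ Γ = 0 ∧ ∀ γ : Curve X, γ ∉ Γ →
    ∀ᵐ t, t ∈ Ioo (0 : ℝ) 1 → γ.toFun t ∈ Ω →
      ENNReal.ofReal |deriv (fun s => v (γ.toFun s)) t| ≤ g (γ.toFun t) * speed γ.toFun t

theorem IsWeakUpperGradientOn.isDerivGradientOn [OpensMeasurableSpace X] (hΩ : IsOpen Ω)
    (hg : Measurable g) (hfin : ∫⁻ x in Ω, g x ∂μ < ⊤) (h : IsWeakUpperGradientOn μ g v Ω) :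
    IsDerivGradientOn μ g v Ω := by
  obtain ⟨Γ, hΓ, hug⟩ := h
  rw [← lintegral_indicator hΩ.measurableSet] at hfin
  refine ⟨_, mod1_union_eq_zero (mod1_subcurves_eq_zero hΓ)
    (mod1_curveIntegral_eq_top (hg.indicator hΩ.measurableSet) hfin), fun γ hγ => ?_⟩
  simp only [mem_union, mem_ofPred_eq, not_or, not_exists] at hγ
  obtain ⟨hsub, htop⟩ := hγ
  have key : ∀ p q : ℚ, ∀ᵐ t, 0 ≤ (p : ℝ) → (q : ℝ) ≤ 1 →
      (∀ s ∈ Icc (p : ℝ) q, γ.toFun s ∈ Ω) → t ∈ Ioo (p : ℝ) q →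
      ENNReal.ofReal |deriv (fun s => v (γ.toFun s)) t| ≤ g (γ.toFun t) * speed γ.toFun t := by
    intro p q
    by_cases hpq : 0 ≤ (p : ℝ) ∧ (q : ℝ) ≤ 1 ∧ ∀ s ∈ Icc (p : ℝ) q, γ.toFun s ∈ Ω
    swap
    · exact .of_forall fun t h1 h2 h3 => absurd ⟨h1, h2, h3⟩ hpq
    obtain ⟨hp, hq, hin⟩ := hpq
    have := ae_abs_deriv_le_of_increments (F := fun s => v (γ.toFun s))
      (G := fun t => g (γ.toFun t) * speed γ.toFun t) (a := p) (b := q) ?_ ?_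
    · filter_upwards [this] with t ht _ _ _ using ht
    · calc ∫⁻ t in Icc (p : ℝ) q, g (γ.toFun t) * speed γ.toFun t
          ≤ ∫⁻ t in Icc (p : ℝ) q, Ω.indicator g (γ.toFun t) * speed γ.toFun t := by
            refine setLIntegral_mono' measurableSet_Icc fun t ht => ?_
            rw [indicator_of_mem (hin t ht)]
        _ ≤ curveIntegral (Ω.indicator g) γ := lintegral_mono_set (Icc_subset_Icc hp hq)
        _ < ⊤ := lt_top_iff_ne_top.2 htop
    · intro c d hc hcd hd
      rcases hcd.eq_or_lt with rfl | hcd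
      · simp
      have h0 : 0 ≤ c := hp.trans hc
      have h1 : d ≤ 1 := hd.trans hq
      have := hug _ (hsub c d h0 hcd h1) fun t ht => hin _
        ⟨by nlinarith [ht.1], by nlinarith [ht.2]⟩
      simp only [Curve.sub, mul_one, mul_zero, add_zero, add_sub_cancel] at this
      exact this.trans (curveIntegral_sub_le g γ h0 hcd h1)
  filter_upwards [ae_all_iff.2 fun p => ae_all_iff.2 (key p)] with t ht hmem htΩ
  obtain ⟨p, q, hp, hq, hin, hmem⟩ := exists_rat_Icc_subset hΩ hmem htΩ
  exact ht p q hp hq hin hmem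

theorem IsDerivGradientOn.isWeakUpperGradientOn (hv : LocLipschitzOn v Ω)
    (h : IsDerivGradientOn μ g v Ω) : IsWeakUpperGradientOn μ g v Ω := by
  obtain ⟨Γ, hΓ, hd⟩ := h
  refine ⟨Γ, hΓ, fun γ hγ hin => ?_⟩
  obtain ⟨K, hK⟩ := exists_lipschitzOnWith_comp hv hin
  refine ofReal_abs_sub_le_lintegral_deriv hK ?_
  filter_upwards [hd γ hγ] with t ht hmem using ht hmem (hin t (Ioo_subset_Icc_self hmem))

/-- Along every curve, a function that is locally Lipschitz in an open set is differentiable at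
almost every parameter at which the curve is in the set. -/
theorem ae_differentiableAt_comp (hΩ : IsOpen Ω) (hv : LocLipschitzOn v Ω) (γ : Curve X) :
    ∀ᵐ t, t ∈ Ioo (0 : ℝ) 1 → γ.toFun t ∈ Ω →
      DifferentiableAt ℝ (fun s => v (γ.toFun s)) t := by
  have key : ∀ p q : ℚ, ∀ᵐ t, 0 ≤ (p : ℝ) → (q : ℝ) ≤ 1 →
      (∀ s ∈ Icc (p : ℝ) q, γ.toFun s ∈ Ω) → t ∈ Ioo (p : ℝ) q →
      DifferentiableAt ℝ (fun s => v (γ.toFun s)) t := by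
    intro p q
    by_cases hpq : 0 ≤ (p : ℝ) ∧ (q : ℝ) ≤ 1 ∧ ∀ s ∈ Icc (p : ℝ) q, γ.toFun s ∈ Ω
    swap
    · exact .of_forall fun t h1 h2 h3 => absurd ⟨h1, h2, h3⟩ hpq
    obtain ⟨hp, hq, hin⟩ := hpq
    obtain ⟨K, hK⟩ := γ.lipschitz
    have hK' := hK.mono (Icc_subset_Icc hp hq)
    obtain ⟨L, hL⟩ := hv (γ.toFun '' Icc (p : ℝ) q)
      (isCompact_Icc.image_of_continuousOn hK'.continuousOn) (image_subset_iff.2 hin)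
    have hcomp := (hL.comp hK' (mapsTo_image _ _)).mono Ioo_subset_Icc_self
    filter_upwards [(ae_restrict_iff' measurableSet_Ioo).1
      (hcomp.ae_differentiableWithinAt_real measurableSet_Ioo)] with t ht _ _ _ hmem
    exact (ht hmem).differentiableAt (Ioo_mem_nhds hmem.1 hmem.2)
  filter_upwards [ae_all_iff.2 fun p => ae_all_iff.2 (key p)] with t ht hmem htΩ
  obtain ⟨p, q, hp, hq, hin, hmem⟩ := exists_rat_Icc_subset hΩ hmem htΩ
  exact ht p q hp hq hin hmem

end Gradients

section TotalVariation

variable {μ : Measure X} {u : X → ℝ} {Ω : Set X}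

theorem _root_.LipschitzWith.locLipschitzOn {L : ℝ≥0} {f : X → ℝ} (hf : LipschitzWith L f)
    (Ω : Set X) : LocLipschitzOn f Ω :=
  fun _ _ _ => ⟨L, hf.lipschitzOnWith⟩

theorem LocLipschitzOn.mono {f : X → ℝ} {Ω' : Set X} (hf : LocLipschitzOn f Ω) (h : Ω' ⊆ Ω) :
    LocLipschitzOn f Ω' :=
  fun K hK hKΩ => hf K hK (hKΩ.trans h)

theorem LocLipschitzOn.continuousOn [LocallyCompactSpace X] {f : X → ℝ}
    (hf : LocLipschitzOn f Ω) (hΩ : IsOpen Ω) : ContinuousOn f Ω := by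
  intro x hx
  obtain ⟨K, hK, hxK, hKΩ⟩ := exists_compact_subset hΩ hx
  obtain ⟨L, hL⟩ := hf K hK hKΩ
  exact (hL.continuousOn.continuousAt (mem_interior_iff_mem_nhds.1 hxK)).continuousWithinAt

theorem IsDerivGradientOn.mono {g : X → ℝ≥0∞} {v : X → ℝ} {Ω' : Set X}
    (hv : IsDerivGradientOn μ g v Ω) (h : Ω' ⊆ Ω) : IsDerivGradientOn μ g v Ω' := by
  obtain ⟨Γ, hΓ, hd⟩ := hv
  refine ⟨Γ, hΓ, fun γ hγ => ?_⟩
  filter_upwards [hd γ hγ] with t ht hmem hin using ht hmem (h hin)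

theorem tv_mono {Ω' : Set X} (h : Ω' ⊆ Ω) : tv μ u Ω' ≤ tv μ u Ω := by
  refine le_iInf fun v => le_iInf fun hv => le_iInf fun hvu => le_iInf fun g => le_iInf fun hg =>
    le_iInf fun hug => ?_
  refine le_trans ?_ (liminf_le_liminf (.of_forall fun i => lintegral_mono_set (f := g i) h))
  refine iInf_le_of_le v <| iInf_le_of_le (fun i => (hv i).mono h) <|
    iInf_le_of_le (fun K hK hKΩ => hvu K hK (hKΩ.trans h)) <| iInf_le_of_le g <|
    iInf_le_of_le hg <| iInf_le _ fun i => ?_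
  obtain ⟨Γ, hΓ, hd⟩ := hug i
  exact ⟨Γ, hΓ, fun γ hγ hin => hd γ hγ fun t ht => h (hin t ht)⟩

theorem tvs_le_tv {A U : Set X} (hU : IsOpen U) (h : A ⊆ U) : tvs μ u A ≤ tv μ u U :=
  iInf₂_le_of_le U hU (iInf_le _ h)

theorem tv_le_liminf {v : ℕ → X → ℝ} (hv : ∀ i, LocLipschitzOn (v i) Ω)
    (hvu : TendstoL1Loc μ v u Ω) {g : ℕ → X → ℝ≥0∞} (hg : ∀ i, Measurable (g i))
    (hd : ∀ i, IsDerivGradientOn μ (g i) (v i) Ω) :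
    tv μ u Ω ≤ liminf (fun i => ∫⁻ x in Ω, g i x ∂μ) atTop :=
  iInf_le_of_le v <| iInf_le_of_le hv <| iInf_le_of_le hvu <| iInf_le_of_le g <|
    iInf_le_of_le hg <| iInf_le _ fun i => (hd i).isWeakUpperGradientOn (hv i)

theorem tv_le_of_tendsto {v : ℕ → X → ℝ} (hv : ∀ i, LocLipschitzOn (v i) Ω)
    (hvu : TendstoL1Loc μ v u Ω) {g : ℕ → X → ℝ≥0∞} (hg : ∀ i, Measurable (g i))
    (hd : ∀ i, IsDerivGradientOn μ (g i) (v i) Ω) {c : ℝ≥0∞}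
    (hc : ∀ᶠ i in atTop, ∫⁻ x in Ω, g i x ∂μ ≤ c) : tv μ u Ω ≤ c :=
  (tv_le_liminf hv hvu hg hd).trans (liminf_le_of_frequently_le' hc.frequently)

/-- Functions of almost minimal total variation admit measurable, locally Lipschitz
approximations all of whose energies are close to the total variation. -/
theorem exists_seq_of_tv_lt [BorelSpace X] [LocallyCompactSpace X] (hΩ : IsOpen Ω) {c : ℝ≥0∞}
    (h : tv μ u Ω < c) : ∃ (v : ℕ → X → ℝ) (g : ℕ → X → ℝ≥0∞), (∀ i, LocLipschitzOn (v i) Ω) ∧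
      (∀ i, Measurable (v i)) ∧ TendstoL1Loc μ v u Ω ∧ (∀ i, Measurable (g i)) ∧
      (∀ i, IsDerivGradientOn μ (g i) (v i) Ω) ∧ ∀ i, ∫⁻ x in Ω, g i x ∂μ < c := by
  simp only [tv, iInf_lt_iff] at h
  obtain ⟨v, hv, hvu, g, hg, hug, hlim⟩ := h
  obtain ⟨φ, hφ, hlt⟩ := extraction_of_frequently_atTop (frequently_lt_of_liminf_lt isCobounded_ge_of_top hlim)
  have hind : ∀ i, EqOn (Ω.indicator (v i)) (v i) Ω := fun i x hx => indicator_of_mem hx _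
  refine ⟨fun i => Ω.indicator (v (φ i)), fun i => g (φ i), fun i K hK hKΩ => ?_, fun i => ?_,
    fun K hK hKΩ => ?_, fun i => hg _, fun i => ?_, hlt⟩
  · obtain ⟨L, hL⟩ := hv (φ i) K hK hKΩ
    refine ⟨L, fun x hx y hy => ?_⟩
    simp only [hind _ (hKΩ hx), hind _ (hKΩ hy)]
    exact hL hx hy
  · classical
    simp only [← piecewise_eq_indicator]
    exact ((hv _).continuousOn hΩ).measurable_piecewise continuousOn_const hΩ.measurableSet
  · refine ((hvu K hK hKΩ).comp hφ.tendsto_atTop).congr fun i => ?_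
    refine setLIntegral_congr_fun hK.measurableSet fun x hx => ?_
    simp only [hind _ (hKΩ hx)]
  · refine IsWeakUpperGradientOn.isDerivGradientOn hΩ (hg _) ((hlt i).trans_le le_top) ?_
    obtain ⟨Γ, hΓ, hd⟩ := hug (φ i)
    refine ⟨Γ, hΓ, fun γ hγ hin => ?_⟩
    simp only [hind _ (hin 0 (by simp)), hind _ (hin 1 (by simp))]
    exact hd γ hγ hin

end TotalVariation

section Truncation

/-- The truncation `min ((k - z)₊) h`. -/
def trunc (k h z : ℝ) : ℝ := max 0 (min (k - z) h)

variable {k h : ℝ}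

theorem trunc_nonneg (k h z : ℝ) : 0 ≤ trunc k h z := le_max_left _ _

theorem trunc_le (hh : 0 ≤ h) (z : ℝ) : trunc k h z ≤ h := max_le hh (min_le_right _ _)

theorem continuous_trunc (k h : ℝ) : Continuous (trunc k h) := by
  unfold trunc; fun_prop

theorem trunc_of_mem {z : ℝ} (hz : z ∈ Ioo (k - h) k) : trunc k h z = k - z := by
  rw [trunc, min_eq_left (by linarith [hz.1]), max_eq_right (by linarith [hz.2])]

theorem trunc_of_le {z : ℝ} (hz : k ≤ z) : trunc k h z = 0 :=
  max_eq_left ((min_le_left _ _).trans (by linarith))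

theorem trunc_of_ge (hh : 0 ≤ h) {z : ℝ} (hz : z ≤ k - h) : trunc k h z = h := by
  rw [trunc, min_eq_right (by linarith), max_eq_right hh]

theorem abs_trunc_sub_le (k h a b : ℝ) : |trunc k h a - trunc k h b| ≤ |a - b| := by
  unfold trunc
  calc |max 0 (min (k - a) h) - max 0 (min (k - b) h)|
      ≤ max |(0 : ℝ) - 0| |min (k - a) h - min (k - b) h| := abs_max_sub_max_le_max _ _ _ _
    _ ≤ max |(0 : ℝ) - 0| (max |k - a - (k - b)| |h - h|) :=
      max_le_max_left _ (abs_min_sub_min_le_max _ _ _ _)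
    _ = |a - b| := by
      rw [sub_self, sub_self, abs_zero, max_eq_right (le_max_right _ _),
        max_eq_left (abs_nonneg _), sub_sub_sub_cancel_left, abs_sub_comm]

theorem trunc_antitone (k h : ℝ) : Antitone (trunc k h) := fun _ _ hab =>
  max_le_max_left _ (min_le_min_right _ (by linarith))

theorem abs_add_mul_trunc_sub_le {e : ℝ} (he : e ∈ Icc (0 : ℝ) 1) (a b : ℝ) :
    |(a + e * trunc k h a) - (b + e * trunc k h b)| ≤ |a - b| := by
  wlog hab : b ≤ a generalizing a b
  · rw [abs_sub_comm, abs_sub_comm a]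
    exact this b a (le_of_not_ge hab)
  have h1 := trunc_antitone k h hab
  have h2 := (abs_le.1 (abs_trunc_sub_le k h a b)).1
  rw [abs_of_nonneg (sub_nonneg.2 hab)] at h2 ⊢
  rw [abs_le]
  constructor <;> nlinarith [he.1, he.2]

theorem abs_deriv_le_add {F E G : ℝ → ℝ} {t c : ℝ} (hF : DifferentiableAt ℝ F t)
    (hE : DifferentiableAt ℝ E t) (hc : 0 ≤ c)
    (h : ∀ᶠ s in 𝓝 t, |G s - G t| ≤ |F s - F t| + c * |E s - E t|) :
    |deriv G t| ≤ |deriv F t| + c * |deriv E t| := by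
  by_cases hG : DifferentiableAt ℝ G t
  swap
  · rw [deriv_zero_of_not_differentiableAt hG, abs_zero]; positivity
  have hs := fun {f : ℝ → ℝ} (hf : DifferentiableAt ℝ f t) =>
    (hasDerivAt_iff_tendsto_slope.1 hf.hasDerivAt).abs
  refine le_of_tendsto_of_tendsto (hs hG) ((hs hF).add ((hs hE).const_mul c)) ?_
  filter_upwards [h.filter_mono nhdsWithin_le_nhds] with s hs
  simp only [slope_def_field, abs_div]
  rw [← mul_div_assoc, ← add_div]
  gcongr

/-- The truncation has derivative at most that of `F`, and zero derivative off the level band. -/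
theorem abs_deriv_trunc_comp_le (hh : 0 ≤ h) {F : ℝ → ℝ} {t : ℝ} (hF : DifferentiableAt ℝ F t) :
    |deriv (fun s => trunc k h (F s)) t| ≤ (Ioo (k - h) k).indicator 1 (F t) * |deriv F t| := by
  by_cases hmem : F t ∈ Ioo (k - h) k
  · rw [indicator_of_mem hmem, Pi.one_apply, one_mul]
    simpa using abs_deriv_le_add (E := 0) hF (differentiableAt_const 0) le_rfl
      (.of_forall fun s => by simpa using abs_trunc_sub_le k h (F s) (F t))
  · rw [indicator_of_notMem hmem, zero_mul]
    rcases le_or_gt k (F t) with hk | hk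
    · rw [IsLocalMin.deriv_eq_zero, abs_zero]
      exact .of_forall fun s => by simpa only [trunc_of_le hk] using trunc_nonneg k h (F s)
    · have : F t ≤ k - h := not_lt.1 fun hlt => hmem ⟨hlt, hk⟩
      rw [IsLocalMax.deriv_eq_zero, abs_zero]
      exact .of_forall fun s => by simpa only [trunc_of_ge hh this] using trunc_le hh (F s)

theorem abs_deriv_add_mul_trunc_le {δ : ℝ} (hδ : 0 ≤ δ) {F E : ℝ → ℝ} {t : ℝ}
    (hF : DifferentiableAt ℝ F t) (hE : DifferentiableAt ℝ E t) (hE01 : ∀ s, E s ∈ Icc (0 : ℝ) 1) :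
    |deriv (fun s => F s + E s * (trunc k h (F s) + δ)) t| ≤
      (1 - E t * (Ioo (k - h) k).indicator 1 (F t)) * |deriv F t| +
        (trunc k h (F t) + δ) * |deriv E t| := by
  have hw := trunc_nonneg k h (F t)
  by_cases hmem : F t ∈ Ioo (k - h) k
  · rw [indicator_of_mem hmem, Pi.one_apply, mul_one, trunc_of_mem hmem]
    have heq : (fun s => F s + E s * (trunc k h (F s) + δ)) =ᶠ[𝓝 t]
        fun s => F s + E s * (k - F s + δ) := by
      filter_upwards [hF.continuousAt.preimage_mem_nhds (isOpen_Ioo.mem_nhds hmem)] with s hs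
      rw [trunc_of_mem hs]
    have hd : HasDerivAt (fun s => F s + E s * (k - F s + δ))
        (deriv F t + (deriv E t * (k - F t + δ) + E t * (-deriv F t))) t :=
      hF.hasDerivAt.add (hE.hasDerivAt.mul ((hF.hasDerivAt.const_sub k).add_const δ))
    rw [heq.deriv_eq, hd.deriv]
    have h1 : 0 ≤ 1 - E t := by linarith [(hE01 t).2]
    have h2 : 0 ≤ k - F t + δ := by linarith [hmem.2]
    calc _ = |(1 - E t) * deriv F t + (k - F t + δ) * deriv E t| := by congr 1; ring
      _ ≤ _ := (abs_add_le _ _).trans_eq (by rw [abs_mul, abs_mul, abs_of_nonneg h1, abs_of_nonneg h2])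
  · rw [indicator_of_notMem hmem, mul_zero, sub_zero, one_mul]
    refine abs_deriv_le_add hF hE (by positivity) (.of_forall fun s => ?_)
    calc _ = |((F s + E s * trunc k h (F s)) - (F t + E s * trunc k h (F t))) +
          (trunc k h (F t) + δ) * (E s - E t)| := by congr 1; ring
      _ ≤ _ := (abs_add_le _ _).trans (add_le_add (abs_add_mul_trunc_sub_le (hE01 s) _ _)
          (by rw [abs_mul, abs_of_nonneg (by positivity : 0 ≤ trunc k h (F t) + δ)]))

theorem abs_mul_trunc_sub_le (hh : 0 ≤ h) {δ : ℝ} (hδ : 0 ≤ δ) {e e' : ℝ} (he : e ∈ Icc (0 : ℝ) 1)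
    (a b : ℝ) : |e * (trunc k h a + δ) - e' * (trunc k h b + δ)| ≤
      |a - b| + (h + δ) * |e - e'| := by
  have h1 := trunc_nonneg k h b
  have h2 : trunc k h b ≤ h := trunc_le hh b
  calc _ = |e * (trunc k h a - trunc k h b) + (trunc k h b + δ) * (e - e')| := by congr 1; ring
    _ ≤ |e * (trunc k h a - trunc k h b)| + |(trunc k h b + δ) * (e - e')| := abs_add_le _ _
    _ ≤ _ := by
      rw [abs_mul, abs_mul, abs_of_nonneg he.1,
        abs_of_nonneg (by positivity : 0 ≤ trunc k h b + δ)]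
      refine add_le_add ?_ (by gcongr)
      exact (mul_le_of_le_one_left (abs_nonneg _) he.2).trans (abs_trunc_sub_le k h a b)

end Truncation

section CutoffGradients

variable {μ : Measure X} {g : X → ℝ≥0∞} {v η : X → ℝ} {Ω : Set X} {k h δ : ℝ} {L : ℝ≥0}

theorem eventually_eq_zero_of_notMem_tsupport (γ : Curve X) {t : ℝ} (ht : t ∈ Ioo (0 : ℝ) 1)
    (hmem : γ.toFun t ∉ tsupport η) : ∀ᶠ s in 𝓝 t, η (γ.toFun s) = 0 :=
  (γ.continuousAt ht).eventually (notMem_tsupport_iff_eventuallyEq.1 hmem)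

theorem ofReal_abs_deriv_cutoff_le (hη : LipschitzWith L η) (γ : Curve X) {t : ℝ}
    (ht : t ∈ Ioo (0 : ℝ) 1) : ENNReal.ofReal |deriv (fun s => η (γ.toFun s)) t| ≤
      (tsupport η).indicator (fun _ => (L : ℝ≥0∞)) (γ.toFun t) * speed γ.toFun t := by
  by_cases hmem : γ.toFun t ∈ tsupport η
  · rw [indicator_of_mem hmem]
    exact ofReal_abs_deriv_comp_le hη _ t
  · have := eventually_eq_zero_of_notMem_tsupport γ ht hmem
    rw [EventuallyEq.deriv_eq (f := fun _ => (0 : ℝ)) this]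
    simp

theorem IsDerivGradientOn.trunc_comp (hΩ : IsOpen Ω) (hv : LocLipschitzOn v Ω)
    (hd : IsDerivGradientOn μ g v Ω) (hh : 0 ≤ h) :
    IsDerivGradientOn μ ((v ⁻¹' Ioo (k - h) k).indicator g) (fun y => trunc k h (v y)) Ω := by
  obtain ⟨Γ, hΓ, hd⟩ := hd
  refine ⟨Γ, hΓ, fun γ hγ => ?_⟩
  filter_upwards [hd γ hγ, ae_differentiableAt_comp hΩ hv γ] with t hd hdiff ht htΩ
  have h1 := abs_deriv_trunc_comp_le (k := k) hh (hdiff ht htΩ)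
  by_cases hmem : γ.toFun t ∈ v ⁻¹' Ioo (k - h) k
  · rw [indicator_of_mem hmem]
    rw [indicator_of_mem (mem_preimage.1 hmem), Pi.one_apply, one_mul] at h1
    exact (ENNReal.ofReal_le_ofReal h1).trans (hd ht htΩ)
  · rw [indicator_of_notMem (by exact hmem), zero_mul] at h1
    exact (ENNReal.ofReal_le_ofReal h1).trans (by simp)

theorem IsDerivGradientOn.add_mul_trunc (hΩ : IsOpen Ω) (hv : LocLipschitzOn v Ω)
    (hd : IsDerivGradientOn μ g v Ω) (hδ : 0 ≤ δ) (hη : LipschitzWith L η)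
    (hη01 : ∀ y, η y ∈ Icc (0 : ℝ) 1) :
    IsDerivGradientOn μ
      (fun y => ENNReal.ofReal (1 - η y * (Ioo (k - h) k).indicator 1 (v y)) * g y +
        ENNReal.ofReal (trunc k h (v y) + δ) * (tsupport η).indicator (fun _ => (L : ℝ≥0∞)) y)
      (fun y => v y + η y * (trunc k h (v y) + δ)) Ω := by
  obtain ⟨Γ, hΓ, hd⟩ := hd
  refine ⟨Γ, hΓ, fun γ hγ => ?_⟩
  filter_upwards [hd γ hγ, ae_differentiableAt_comp hΩ hv γ,
    ae_differentiableAt_comp hΩ (hη.locLipschitzOn Ω) γ] with t hd hdiff hdiffη ht htΩ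
  refine (ENNReal.ofReal_le_ofReal (abs_deriv_add_mul_trunc_le (k := k) (h := h) hδ (hdiff ht htΩ)
    (hdiffη ht htΩ) fun s => hη01 _)).trans ?_
  refine ENNReal.ofReal_add_le.trans ?_
  rw [ENNReal.ofReal_mul' (abs_nonneg _), ENNReal.ofReal_mul' (abs_nonneg _), add_mul, mul_assoc,
    mul_assoc]
  gcongr
  · exact hd ht htΩ
  · exact ofReal_abs_deriv_cutoff_le hη γ ht

theorem IsDerivGradientOn.mul_trunc {Ω' : Set X} (hΩ : IsOpen Ω) (hv : LocLipschitzOn v Ω)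
    (hd : IsDerivGradientOn μ g v Ω) (hh : 0 ≤ h) (hδ : 0 ≤ δ) (hη : LipschitzWith L η)
    (hη01 : ∀ y, η y ∈ Icc (0 : ℝ) 1) (hsupp : tsupport η ⊆ Ω) :
    IsDerivGradientOn μ
      (fun y => Ω.indicator g y +
        ENNReal.ofReal (h + δ) * (tsupport η).indicator (fun _ => (L : ℝ≥0∞)) y)
      (fun y => η y * (trunc k h (v y) + δ)) Ω' := by
  obtain ⟨Γ, hΓ, hd⟩ := hd
  refine ⟨Γ, hΓ, fun γ hγ => ?_⟩
  filter_upwards [hd γ hγ, ae_differentiableAt_comp hΩ hv γ,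
    ae_differentiableAt_comp hΩ (hη.locLipschitzOn Ω) γ] with t hd hdiff hdiffη ht htΩ
  by_cases hmem : γ.toFun t ∈ tsupport η
  · have htΩ := hsupp hmem
    rw [indicator_of_mem htΩ, add_mul, mul_assoc]
    refine (ENNReal.ofReal_le_ofReal (abs_deriv_le_add (c := h + δ) (hdiff ht htΩ) (hdiffη ht htΩ)
      (by positivity) (.of_forall fun s => abs_mul_trunc_sub_le hh hδ (hη01 _) _ _))).trans ?_
    refine ENNReal.ofReal_add_le.trans ?_
    rw [ENNReal.ofReal_mul' (abs_nonneg _)]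
    gcongr
    · exact hd ht htΩ
    · exact ofReal_abs_deriv_cutoff_le hη γ ht
  · have hz := eventually_eq_zero_of_notMem_tsupport γ ht hmem
    rw [EventuallyEq.deriv_eq (f := fun _ => (0 : ℝ)) (hz.mono fun s hs => by simp [hs])]
    simp

theorem LocLipschitzOn.trunc_comp (hv : LocLipschitzOn v Ω) :
    LocLipschitzOn (fun y => trunc k h (v y)) Ω := fun K hK hKΩ => by
  obtain ⟨M, hM⟩ := hv K hK hKΩ
  refine ⟨M, LipschitzOnWith.of_dist_le_mul fun a ha b hb => ?_⟩
  exact (abs_trunc_sub_le k h _ _).trans (hM.dist_le_mul a ha b hb)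

theorem LocLipschitzOn.add_mul_trunc (hv : LocLipschitzOn v Ω) (hh : 0 ≤ h) (hδ : 0 ≤ δ)
    (hη : LipschitzWith L η) (hη01 : ∀ y, η y ∈ Icc (0 : ℝ) 1) :
    LocLipschitzOn (fun y => v y + η y * (trunc k h (v y) + δ)) Ω := fun K hK hKΩ => by
  obtain ⟨M, hM⟩ := hv K hK hKΩ
  refine ⟨M + (M + (h + δ).toNNReal * L), LipschitzOnWith.of_dist_le_mul
    fun a ha b hb => ?_⟩
  have h1 := hM.dist_le_mul a ha b hb
  have h2 := hη.dist_le_mul a b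
  have h3 := abs_mul_trunc_sub_le (k := k) hh hδ (hη01 a) (e' := η b) (v a) (v b)
  rw [Real.dist_eq] at h1 h2
  have h4 : (h + δ) * |η a - η b| ≤ (h + δ) * (L * dist a b) := by gcongr
  calc dist (v a + η a * (trunc k h (v a) + δ)) (v b + η b * (trunc k h (v b) + δ))
      = |(v a - v b) + (η a * (trunc k h (v a) + δ) -
          η b * (trunc k h (v b) + δ))| := by rw [Real.dist_eq]; congr 1; ring
    _ ≤ _ := abs_add_le _ _
    _ ≤ M * dist a b + (M * dist a b + (h + δ) * (L * dist a b)) := by linarith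
    _ = _ := by
      push_cast [Real.coe_toNNReal _ (add_nonneg hh hδ)]; ring

theorem LocLipschitzOn.lipschitzWith_mul_trunc (hv : LocLipschitzOn v Ω) (hh : 0 ≤ h)
    (hδ : 0 ≤ δ) (hη : LipschitzWith L η) (hη01 : ∀ y, η y ∈ Icc (0 : ℝ) 1)
    (hcomp : IsCompact (tsupport η)) (hsupp : tsupport η ⊆ Ω) :
    ∃ M, LipschitzWith M (fun y => η y * (trunc k h (v y) + δ)) := by
  obtain ⟨M, hM⟩ := hv _ hcomp hsupp
  obtain ⟨f, hf, hfv⟩ := hM.extend_real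
  have heq : (fun y => η y * (trunc k h (v y) + δ)) =
      fun y => η y * (trunc k h (f y) + δ) := by
    ext y
    by_cases hy : y ∈ tsupport η
    · rw [hfv hy]
    · rw [image_eq_zero_of_notMem_tsupport hy, zero_mul, zero_mul]
  rw [heq]
  refine ⟨M + (h + δ).toNNReal * L, LipschitzWith.of_dist_le_mul fun a b => ?_⟩
  have h1 := hf.dist_le_mul a b
  have h2 := hη.dist_le_mul a b
  rw [Real.dist_eq] at h1 h2
  refine (abs_mul_trunc_sub_le (k := k) hh hδ (hη01 a) (e' := η b) (f a) (f b)).trans ?_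
  have h4 : (h + δ) * |η a - η b| ≤ (h + δ) * (L * dist a b) := by gcongr
  calc _ ≤ M * dist a b + (h + δ) * (L * dist a b) := by linarith
    _ = _ := by
      push_cast [Real.coe_toNNReal _ (add_nonneg hh hδ)]; ring

end CutoffGradients

section Caccioppoli

variable {μ : Measure X} {u η : X → ℝ} {Ω U W : Set X} {k h δ : ℝ} {L : ℝ≥0}

theorem exists_cutoff (x : X) {s s' : ℝ} (hs : s < s') : ∃ η : X → ℝ,
    LipschitzWith (1 / (s' - s)).toNNReal η ∧ (∀ y, η y ∈ Icc (0 : ℝ) 1) ∧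
      (∀ y ∈ closedBall x s, η y = 1) ∧ tsupport η ⊆ closedBall x s' := by
  have hpos : 0 < s' - s := sub_pos.2 hs
  refine ⟨fun y => max 0 (min 1 ((s' - dist y x) / (s' - s))),
    LipschitzWith.of_dist_le_mul fun a b => ?_, fun y => ⟨le_max_left _ _,
      max_le zero_le_one (min_le_left _ _)⟩, fun y hy => ?_, ?_⟩
  · rw [Real.coe_toNNReal _ (by positivity)]
    calc _ ≤ max |(0 : ℝ) - 0| |min 1 ((s' - dist a x) / (s' - s)) -
          min 1 ((s' - dist b x) / (s' - s))| := abs_max_sub_max_le_max _ _ _ _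
      _ ≤ max |(0 : ℝ) - 0| (max |(1 : ℝ) - 1|
          |(s' - dist a x) / (s' - s) - (s' - dist b x) / (s' - s)|) :=
        max_le_max_left _ (abs_min_sub_min_le_max _ _ _ _)
      _ = |dist b x - dist a x| / (s' - s) := by
        rw [sub_self, sub_self, abs_zero, max_eq_right (le_max_left _ _),
          max_eq_right (abs_nonneg _), ← sub_div, sub_sub_sub_cancel_left, abs_div,
          abs_of_pos hpos]
      _ ≤ dist a b / (s' - s) := by
        gcongr
        rw [dist_comm a b]
        exact abs_dist_sub_le b a x
      _ = _ := by ring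
  · rw [mem_closedBall] at hy
    have : 1 ≤ (s' - dist y x) / (s' - s) := by rw [le_div_iff₀ hpos]; linarith
    simp only [min_eq_left this, max_eq_right zero_le_one]
  · refine closure_minimal (fun y hy => ?_) isClosed_closedBall
    by_contra hmem
    rw [mem_closedBall, not_le] at hmem
    refine hy (max_eq_left ((min_le_right _ _).trans ?_))
    exact div_nonpos_of_nonpos_of_nonneg (by linarith) hpos.le

theorem MemBV.mul_trunc [BorelSpace X] [LocallyCompactSpace X] [IsLocallyFiniteMeasure μ]
    (hU : IsOpen U) (hu : MemBV μ u U) (hh : 0 ≤ h) (hδ : 0 ≤ δ) (hη : LipschitzWith L η)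
    (hη01 : ∀ y, η y ∈ Icc (0 : ℝ) 1) (hcomp : IsCompact (tsupport η)) (hsupp : tsupport η ⊆ U) :
    MemBV μ (fun y => η y * (trunc k h (u y) + δ)) Ω := by
  have hK := hcomp.measurableSet
  have hzero : ∀ y ∉ tsupport η, η y = 0 := fun y => image_eq_zero_of_notMem_tsupport
  constructor
  · refine Integrable.integrableOn ?_
    rw [← integrableOn_iff_integrable_of_support_subset (s := tsupport η)]
    · have : IsFiniteMeasure (μ.restrict (tsupport η)) := ⟨by simpa using hcomp.measure_lt_top⟩
      refine Integrable.of_bound ?_ (h + δ) ?_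
      · exact hη.continuous.aestronglyMeasurable.mul
          (((continuous_trunc k h).comp_aestronglyMeasurable
            (hu.1.mono_set hsupp).aestronglyMeasurable).add_const δ)
      · refine .of_forall fun y => ?_
        have h1 := trunc_nonneg k h (u y)
        rw [Real.norm_eq_abs, abs_of_nonneg (mul_nonneg (hη01 y).1 (by positivity))]
        exact (mul_le_of_le_one_left (by positivity) (hη01 y).2).trans
          (by linarith [trunc_le (k := k) hh (u y)])
    · intro y hy
      by_contra hmem
      exact hy (by simp only [hzero y hmem, zero_mul])
  · obtain ⟨c, hc, hcU⟩ : ∃ c, tv μ u U < c ∧ c < ⊤ := exists_between hu.2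
    obtain ⟨v, g, hv, -, hvu, hg, hd, hlt⟩ := exists_seq_of_tv_lt hU hc
    have hbound : ENNReal.ofReal (h + δ) * (L * μ (tsupport η)) < ⊤ :=
      ENNReal.mul_lt_top ENNReal.ofReal_lt_top
        (ENNReal.mul_lt_top ENNReal.coe_lt_top hcomp.measure_lt_top)
    refine (tv_le_of_tendsto (c := c + ENNReal.ofReal (h + δ) * (L * μ (tsupport η)))
      (v := fun i y => η y * (trunc k h (v i y) + δ))
      (fun i => ?_) (fun K' hK' _ => ?_) (fun i => ?_)
      (fun i => (hd i).mul_trunc hU (hv i) hh hδ hη hη01 hsupp)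
      (.of_forall fun i => ?_)).trans_lt (ENNReal.add_lt_top.2 ⟨hcU, hbound⟩)
    · obtain ⟨M, hM⟩ := (hv i).lipschitzWith_mul_trunc (k := k) hh hδ hη hη01 hcomp hsupp
      exact hM.locLipschitzOn _
    · refine tendsto_of_tendsto_of_tendsto_of_le_of_le tendsto_const_nhds
        (hvu _ hcomp hsupp) (fun _ => zero_le) fun i => ?_
      calc _ ≤ ∫⁻ y in K', (tsupport η).indicator
            (fun y => ENNReal.ofReal |v i y - u y|) y ∂μ := by
            refine lintegral_mono fun y => ?_
            by_cases hy : y ∈ tsupport η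
            · rw [indicator_of_mem hy]
              refine ENNReal.ofReal_le_ofReal ?_
              simpa using abs_mul_trunc_sub_le (k := k) hh hδ (hη01 y) (e' := η y) (v i y) (u y)
            · simp [hzero y hy]
        _ ≤ _ := by
            rw [← lintegral_indicator hK]
            exact setLIntegral_le_lintegral _ _
    · exact ((hg i).indicator hU.measurableSet).add
        ((measurable_const.indicator hK).const_mul _)
    · refine (setLIntegral_le_lintegral _ _).trans ?_
      rw [lintegral_add_left ((hg i).indicator hU.measurableSet), lintegral_indicator hU.measurableSet,
        lintegral_const_mul _ (measurable_const.indicator hK), lintegral_indicator_const hK]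
      exact add_le_add_left (hlt i).le _

end Caccioppoli

section Caccioppoli

variable {μ : Measure X} {u η : X → ℝ} {Ω U W : Set X} {k h δ : ℝ} {L : ℝ≥0}

theorem ENNReal.le_of_forall_pos_le_add_mul {a b M : ℝ≥0∞} (hM : M ≠ ⊤)
    (h : ∀ ε : ℝ≥0, 0 < ε → a ≤ b + ε * M) : a ≤ b := by
  have ht : Tendsto (fun ε : ℝ≥0 => b + (ε : ℝ≥0∞) * M) (𝓝[>] 0) (𝓝 (b + (0 : ℝ≥0) * M)) :=
    (tendsto_const_nhds.add (ENNReal.Tendsto.mul_const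
      (ENNReal.continuous_coe.tendsto 0) (Or.inr hM))).mono_left nhdsWithin_le_nhds
  simp only [ENNReal.coe_zero, zero_mul, add_zero] at ht
  exact ge_of_tendsto ht (eventually_mem_nhdsWithin.mono fun ε hε => h ε hε)

theorem tsupport_mul_trunc (hδ : 0 < δ) :
    tsupport (fun y => η y * (trunc k h (u y) + δ)) = tsupport η := by
  refine congrArg closure (Set.ext fun y => ?_)
  have h1 := trunc_nonneg k h (u y)
  simp [(by positivity : trunc k h (u y) + δ ≠ 0)]

/-- Superminimizers compete with `u + η (w(u) + δ)`, for the truncation `w`. -/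
theorem IsSuperminimizer.tvs_le_tv_add_mul_trunc [BorelSpace X] [LocallyCompactSpace X]
    [IsLocallyFiniteMeasure μ] {V : Set X}
    (hu : IsSuperminimizer μ u Ω) (hU : IsOpen U) (hUΩ : U ⊆ Ω) (huU : MemBV μ u U) (hh : 0 ≤ h)
    (hδ : 0 < δ) (hη : LipschitzWith L η) (hη01 : ∀ y, η y ∈ Icc (0 : ℝ) 1)
    (hcomp : IsCompact (tsupport η)) (hsupp : tsupport η ⊆ U) (hV : IsOpen V)
    (hKV : tsupport η ⊆ V) :
    tvs μ u (tsupport η) ≤ tv μ (fun y => u y + η y * (trunc k h (u y) + δ)) V := by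
  have hφ := hu.2 (fun y => η y * (trunc k h (u y) + δ))
    ⟨huU.mul_trunc hU hh hδ.le hη hη01 hcomp hsupp, by rwa [tsupport_mul_trunc hδ],
      by rw [tsupport_mul_trunc hδ]; exact hsupp.trans hUΩ⟩
    fun y => mul_nonneg (hη01 y).1 (add_nonneg (trunc_nonneg _ _ _) hδ.le)
  rw [tsupport_mul_trunc hδ] at hφ
  exact hφ.trans (tvs_le_tv hV hKV)

theorem measurable_indicator_comp_one {v : X → ℝ} (hv : Measurable v) (k h : ℝ) :
    Measurable fun y => (Ioo (k - h) k).indicator (1 : ℝ → ℝ) (v y) :=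
  (measurable_one.indicator measurableSet_Ioo).comp hv

theorem IsSuperminimizer.tv_trunc_le_of_cutoff [BorelSpace X] [LocallyCompactSpace X]
    [IsLocallyFiniteMeasure μ]
    (hu : IsSuperminimizer μ u Ω) (hU : IsOpen U) (hUΩ : U ⊆ Ω) (huU : MemBV μ u U) (hh : 0 ≤ h)
    (hη : LipschitzWith L η) (hη01 : ∀ y, η y ∈ Icc (0 : ℝ) 1)
    (hcomp : IsCompact (tsupport η)) (hsupp : tsupport η ⊆ U)
    (hWm : MeasurableSet W) (hηW : ∀ y ∈ W, η y = 1) : tv μ (fun y => trunc k h (u y)) W ≤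
      L * ∫⁻ y in tsupport η, ENNReal.ofReal (trunc k h (u y)) ∂μ := by
  have hK := hcomp.measurableSet
  have hKfin : μ (tsupport η) < ⊤ := hcomp.measure_lt_top
  have hWK : W ⊆ tsupport η := fun y hy => subset_tsupport _ (by simp [hηW y hy])
  have huK : AEMeasurable u (μ.restrict (tsupport η)) :=
    (huU.1.mono_set hsupp).aestronglyMeasurable.aemeasurable
  refine ENNReal.le_of_forall_pos_le_add_mul (M := L + L * μ (tsupport η) + 2) ?_ fun ε hε => ?_
  · exact (ENNReal.add_lt_top.2 ⟨ENNReal.add_lt_top.2 ⟨ENNReal.coe_lt_top,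
      ENNReal.mul_lt_top ENNReal.coe_lt_top hKfin⟩, by simp⟩).ne
  have hε' : (ε : ℝ≥0∞) ≠ 0 := ENNReal.coe_ne_zero.2 hε.ne'
  set T := tvs μ u (tsupport η) with hT
  have hTfin : T < ⊤ := (tvs_le_tv hU hsupp).trans_lt huU.2
  obtain ⟨V, hV, hKV, hVU, hVlt⟩ : ∃ V, IsOpen V ∧ tsupport η ⊆ V ∧ V ⊆ U ∧ tv μ u V < T + ε := by
    have : T < T + ε := ENNReal.lt_add_right hTfin.ne hε'
    rw [hT] at this
    nth_rw 1 [tvs] at this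
    simp only [iInf_lt_iff] at this
    obtain ⟨V, hV, hKV, hlt⟩ := this
    exact ⟨V ∩ U, hV.inter hU, subset_inter hKV hsupp, inter_subset_right,
      (tv_mono inter_subset_left).trans_lt hlt⟩
  obtain ⟨v, g, hv, hvm, hvu, hg, hd, hlt⟩ := exists_seq_of_tv_lt hV hVlt
  set β : ℕ → X → ℝ := fun i y => η y * (Ioo (k - h) k).indicator 1 (v i y) with hβ
  have hβm : ∀ i, Measurable (β i) := fun i =>
    hη.continuous.measurable.mul (measurable_indicator_comp_one (hvm i) k h)
  have hβ01 : ∀ i y, β i y ∈ Icc (0 : ℝ) 1 := fun i y => by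
    have := hη01 y
    by_cases hy : v i y ∈ Ioo (k - h) k
    · simpa [hβ, indicator_of_mem hy] using this
    · simp [hβ, indicator_of_notMem hy]
  set G : ℕ → X → ℝ≥0∞ := fun i y => ENNReal.ofReal (1 - β i y) * g i y +
    ENNReal.ofReal (trunc k h (v i y) + ε) * (tsupport η).indicator (fun _ => (L : ℝ≥0∞)) y with hG
  have hPm : ∀ i, Measurable fun y => ENNReal.ofReal (1 - β i y) * g i y := fun i =>
    ((measurable_const.sub (hβm i)).ennreal_ofReal).mul (hg i)
  have hJm : ∀ i, Measurable fun y => ENNReal.ofReal (trunc k h (v i y) + ε) *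
      (tsupport η).indicator (fun _ => (L : ℝ≥0∞)) y := fun i =>
    ((((continuous_trunc k h).measurable.comp (hvm i)).add_const _).ennreal_ofReal).mul
      (measurable_const.indicator hK)
  have hlow : T ≤ liminf (fun i => ∫⁻ y in V, G i y ∂μ) atTop := by
    refine (hu.tvs_le_tv_add_mul_trunc (k := k) hU hUΩ huU hh (NNReal.coe_pos.2 hε) hη hη01 hcomp hsupp hV
      hKV).trans (tv_le_liminf (v := fun i y => v i y + η y * (trunc k h (v i y) + ε))
        (fun i => (hv i).add_mul_trunc hh ε.coe_nonneg hη hη01) (fun K' hK' hK'V => ?_)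
        (fun i => (hPm i).add (hJm i)) fun i => (hd i).add_mul_trunc hV (hv i) ε.coe_nonneg hη hη01)
    refine tendsto_of_tendsto_of_tendsto_of_le_of_le tendsto_const_nhds
      (hvu _ hK' hK'V) (fun _ => zero_le) fun i => lintegral_mono fun y => ?_
    refine ENNReal.ofReal_le_ofReal ?_
    calc _ = |(v i y + η y * trunc k h (v i y)) - (u y + η y * trunc k h (u y))| := by
          congr 1; ring
      _ ≤ _ := abs_add_mul_trunc_sub_le (hη01 y) _ _
  have hev : ∀ᶠ i in atTop, T ≤ ∫⁻ y in V, G i y ∂μ + ε := by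
    rcases eq_or_ne T 0 with h0 | h0
    · exact .of_forall fun i => h0 ▸ zero_le
    · filter_upwards [eventually_lt_of_lt_liminf
        ((ENNReal.sub_lt_self hTfin.ne h0 hε').trans_le hlow)] with i hi
      exact tsub_le_iff_right.1 hi.le
  have hevK : ∀ᶠ i in atTop, ∫⁻ y in tsupport η, ENNReal.ofReal |v i y - u y| ∂μ ≤ ε :=
    (hvu _ hcomp hKV).eventually (ge_mem_nhds (pos_iff_ne_zero.2 hε'))
  refine tv_le_of_tendsto (v := fun i y => trunc k h (v i y))
    (g := fun i => (v i ⁻¹' Ioo (k - h) k).indicator (g i))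
    (fun i => ((hv i).mono (hWK.trans hKV)).trunc_comp) (fun K' hK' hK'W => ?_)
    (fun i => (hg i).indicator (hvm i measurableSet_Ioo))
    (fun i => ((hd i).trunc_comp hV (hv i) hh).mono (hWK.trans hKV)) ?_
  · refine tendsto_of_tendsto_of_tendsto_of_le_of_le tendsto_const_nhds
      (hvu _ hK' (hK'W.trans (hWK.trans hKV))) (fun _ => zero_le) fun i => lintegral_mono fun y => ?_
    exact ENNReal.ofReal_le_ofReal (abs_trunc_sub_le _ _ _ _)
  filter_upwards [hev, hevK] with i hi hiK
  have hsplit : ∫⁻ y in V, g i y ∂μ = ∫⁻ y in V, ENNReal.ofReal (1 - β i y) * g i y ∂μ +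
      ∫⁻ y in V, ENNReal.ofReal (β i y) * g i y ∂μ := by
    rw [← lintegral_add_left (hPm i)]
    refine lintegral_congr fun y => ?_
    rw [← add_mul, ← ENNReal.ofReal_add (by linarith [(hβ01 i y).2]) (hβ01 i y).1, sub_add_cancel,
      ENNReal.ofReal_one, one_mul]
  have hW : ∫⁻ y in W, (v i ⁻¹' Ioo (k - h) k).indicator (g i) y ∂μ ≤
      ∫⁻ y in V, ENNReal.ofReal (β i y) * g i y ∂μ := by
    refine (setLIntegral_mono' hWm fun y hy => ?_).trans (lintegral_mono_set (hWK.trans hKV))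
    by_cases hmem : v i y ∈ Ioo (k - h) k
    · simp [hβ, hηW y hy, indicator_of_mem hmem, indicator_of_mem (mem_preimage.2 hmem)]
    · rw [indicator_of_notMem (by exact hmem)]
      exact zero_le
  have hdiffm : AEMeasurable (fun y => ENNReal.ofReal |v i y - u y|) (μ.restrict (tsupport η)) :=
    ((hvm i).aemeasurable.sub huK).abs.ennreal_ofReal
  have hJ : ∫⁻ y in V, ENNReal.ofReal (trunc k h (v i y) + ε) *
      (tsupport η).indicator (fun _ => (L : ℝ≥0∞)) y ∂μ ≤
      L * (∫⁻ y in tsupport η, ENNReal.ofReal (trunc k h (u y)) ∂μ + ε + ε * μ (tsupport η)) := by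
    calc _ ≤ ∫⁻ y, (tsupport η).indicator
          (fun y => L * ENNReal.ofReal (trunc k h (v i y) + ε)) y ∂μ := by
          refine (setLIntegral_le_lintegral _ _).trans (lintegral_mono fun y => ?_)
          by_cases hy : y ∈ tsupport η <;> simp [hy, mul_comm]
      _ = L * ∫⁻ y in tsupport η, ENNReal.ofReal (trunc k h (v i y) + ε) ∂μ := by
          rw [lintegral_indicator hK, lintegral_const_mul' _ _ ENNReal.coe_ne_top]
      _ ≤ L * ∫⁻ y in tsupport η, (ENNReal.ofReal (trunc k h (u y)) +
          ENNReal.ofReal |v i y - u y| + ε) ∂μ := by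
          gcongr with y
          rw [← ENNReal.ofReal_coe_nnreal, ← ENNReal.ofReal_add (trunc_nonneg _ _ _) (abs_nonneg _),
            ← ENNReal.ofReal_add (add_nonneg (trunc_nonneg _ _ _) (abs_nonneg _)) ε.coe_nonneg]
          refine ENNReal.ofReal_le_ofReal ?_
          have := (abs_le.1 (abs_trunc_sub_le k h (v i y) (u y))).2
          linarith
      _ ≤ _ := by
          rw [lintegral_add_right _ measurable_const,
            lintegral_add_right' _ hdiffm,
            setLIntegral_const]
          gcongr
  have hfin : ∫⁻ y in V, ENNReal.ofReal (1 - β i y) * g i y ∂μ ≠ ⊤ := by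
    refine ((le_self_add.trans hsplit.ge).trans_lt ((hlt i).trans ?_)).ne
    exact ENNReal.add_lt_top.2 ⟨hTfin, ENNReal.coe_lt_top⟩
  have hsum := (hlt i).le
  rw [hsplit] at hsum
  simp only [hG] at hi
  rw [lintegral_add_left (hPm i)] at hi
  refine hW.trans (ENNReal.le_of_add_le_add_left hfin ?_)
  calc _ ≤ _ := hsum.trans (add_le_add_left (hi.trans (add_le_add_left (add_le_add_right hJ _) _)) _)
    _ = _ := by ring

end Caccioppoli

section LocalPoincare

variable {μ : Measure X} {Cd CP lam : ℝ} {u w : X → ℝ} {Ω : Set X} {k h : ℝ}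

theorem IsSuperminimizer.tv_trunc_le [BorelSpace X] [ProperSpace X] [IsLocallyFiniteMeasure μ]
    (hu : IsSuperminimizer μ u Ω) {x : X} {s s' : ℝ} (hs : s < s') (hsub : closedBall x s' ⊆ Ω)
    (hh : 0 ≤ h) : tv μ (fun y => trunc k h (u y)) (ball x s) ≤
      ENNReal.ofReal (1 / (s' - s)) *
        ∫⁻ y in closedBall x s', ENNReal.ofReal (trunc k h (u y)) ∂μ := by
  obtain ⟨U, hU, hKU, hUΩ, huU⟩ := hu.1 _ (isCompact_closedBall x s') hsub
  obtain ⟨η, hη, hη01, hη1, hsupp⟩ := exists_cutoff x hs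
  refine (hu.tv_trunc_le_of_cutoff hU hUΩ huU hh hη hη01
    ((isCompact_closedBall x s').of_isClosed_subset (isClosed_tsupport _) hsupp)
    (hsupp.trans hKU) measurableSet_ball
    fun y hy => hη1 y (ball_subset_closedBall hy)).trans ?_
  gcongr
  exact le_rfl

theorem MMS.exists_lintegral_sub_le [BorelSpace X] (hX : MMS μ Cd CP lam) (y : X) {r : ℝ}
    (hr : 0 < r) {v : X → ℝ} {g : X → ℝ≥0∞} (hv : LocLipschitzOn v Ω)
    (hsub : closedBall y (lam * r) ⊆ Ω) (hg : Measurable g) (hd : IsDerivGradientOn μ g v Ω) :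
    ∃ c : ℝ, ∫⁻ z in ball y r, ENNReal.ofReal |v z - c| ∂μ ≤
      ENNReal.ofReal (CP * r) * ∫⁻ z in ball y (lam * r), g z ∂μ := by
  have := hX.properSpace
  have := hX.isLocallyFiniteMeasure
  obtain ⟨M, hM⟩ := hv _ (isCompact_closedBall _ _) hsub
  obtain ⟨f, hf, hfv⟩ := hM.extend_real
  have hBB : ball y r ⊆ ball y (lam * r) :=
    ball_subset_ball (le_mul_of_one_le_left hr.le hX.hlam)
  have heq : ∀ z ∈ ball y (lam * r), v z = f z := fun z hz => hfv (ball_subset_closedBall hz)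
  set B := ball y (lam * r) with hB
  set G : X → ℝ≥0∞ := fun z => B.indicator g z + Bᶜ.indicator (fun _ => (M : ℝ≥0∞)) z with hG
  have hGm : Measurable G :=
    (hg.indicator measurableSet_ball).add (measurable_const.indicator measurableSet_ball.compl)
  have hGd : IsDerivGradientOn μ G f univ := by
    obtain ⟨Γ, hΓ, hd⟩ := hd
    refine ⟨Γ, hΓ, fun γ hγ => ?_⟩
    filter_upwards [hd γ hγ] with t hd ht _
    by_cases hmem : γ.toFun t ∈ B
    · have hev : ∀ᶠ s in 𝓝 t, f (γ.toFun s) = v (γ.toFun s) :=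
        Filter.mem_of_superset
          ((γ.continuousAt ht).preimage_mem_nhds (isOpen_ball.mem_nhds hmem))
          fun s hs => (heq _ hs).symm
      rw [EventuallyEq.deriv_eq (f := fun s => v (γ.toFun s)) hev]
      simpa [hG, hmem] using hd ht (hsub (ball_subset_closedBall hmem))
    · simpa [hG, hmem] using ofReal_abs_deriv_comp_le hf γ.toFun t
  refine ⟨⨍ z in ball y r, f z ∂μ, ENNReal.le_of_forall_pos_le_add_mul
    (M := ENNReal.ofReal (CP * r)) ENNReal.ofReal_ne_top fun ε hε => ?_⟩
  obtain ⟨ρ, hρ, hρε, hug⟩ := (hGd.isWeakUpperGradientOn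
    (hf.locLipschitzOn univ)).exists_isUpperGradientOn (ENNReal.coe_ne_zero.2 hε.ne')
  calc _ = ∫⁻ z in ball y r, ENNReal.ofReal |f z - ⨍ z in ball y r, f z ∂μ| ∂μ :=
        setLIntegral_congr_fun measurableSet_ball fun z hz => by simp only [heq z (hBB hz)]
    _ ≤ ENNReal.ofReal (CP * r) * (μ (ball y r) / μ B) * ∫⁻ z in B, (G z + ρ z) ∂μ :=
        hX.poincare y r hr f hf.continuous.locallyIntegrable _ (hGm.add hρ) hug
    _ ≤ ENNReal.ofReal (CP * r) * 1 * (∫⁻ z in B, g z ∂μ + ε) := by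
        gcongr
        · exact ENNReal.div_le_of_le_mul (by rw [one_mul]; exact measure_mono hBB)
        · rw [lintegral_add_left hGm]
          refine add_le_add (le_of_eq (setLIntegral_congr_fun measurableSet_ball fun z hz => ?_))
            ((setLIntegral_le_lintegral _ _).trans hρε)
          simp [hG, hz]
    _ = _ := by ring

/-- A nonnegative function vanishing on half of a set is controlled there by its oscillation. -/
theorem setLIntegral_le_three_mul {B : Set X} (hBfin : μ B ≠ ⊤)
    (hw : AEMeasurable w (μ.restrict B)) (hw0 : ∀ y, 0 ≤ w y)
    (hhalf : 2 * μ ({y | 0 < w y} ∩ B) ≤ μ B) (c : ℝ) :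
    ∫⁻ y in B, ENNReal.ofReal (w y) ∂μ ≤ 3 * ∫⁻ y in B, ENNReal.ofReal |w y - c| ∂μ := by
  set I := ∫⁻ y in B, ENNReal.ofReal |w y - c| ∂μ with hI
  have hZ : ENNReal.ofReal |c| * μ ({y | w y = 0} ∩ B) ≤ I := by
    refine le_trans ?_ (mul_meas_ge_le_lintegral₀ (hw.sub_const c).abs.ennreal_ofReal
      (ENNReal.ofReal |c|))
    refine mul_le_mul' le_rfl (le_trans (measure_mono fun y hy => ?_)
      (Measure.le_restrict_apply _ _))
    have h0 : w y = 0 := hy.1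
    simp [h0, hy.2]
  have hcover : μ B ≤ 2 * μ ({y | w y = 0} ∩ B) := by
    have h1 : μ B ≤ μ ({y | 0 < w y} ∩ B) + μ ({y | w y = 0} ∩ B) := by
      refine (measure_mono fun y hy => ?_).trans (measure_union_le _ _)
      rcases (hw0 y).lt_or_eq with h | h
      · exact Or.inl ⟨h, hy⟩
      · exact Or.inr ⟨h.symm, hy⟩
    have h2 : μ B + μ B ≤ μ B + 2 * μ ({y | w y = 0} ∩ B) := by
      calc μ B + μ B = 2 * μ B := (two_mul _).symm
        _ ≤ 2 * (μ ({y | 0 < w y} ∩ B) + μ ({y | w y = 0} ∩ B)) := mul_le_mul' le_rfl h1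
        _ ≤ _ := by rw [mul_add]; exact add_le_add hhalf le_rfl
    exact ENNReal.le_of_add_le_add_left hBfin h2
  calc ∫⁻ y in B, ENNReal.ofReal (w y) ∂μ
      ≤ ∫⁻ y in B, (ENNReal.ofReal |w y - c| + ENNReal.ofReal |c|) ∂μ := by
        refine lintegral_mono fun y => ?_
        rw [← ENNReal.ofReal_add (abs_nonneg _) (abs_nonneg _)]
        exact ENNReal.ofReal_le_ofReal (by linarith [le_abs_self (w y - c), le_abs_self c])
    _ = I + ENNReal.ofReal |c| * μ B := by
        rw [lintegral_add_right _ measurable_const, setLIntegral_const]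
    _ ≤ I + 2 * I := by
        refine add_le_add le_rfl ?_
        calc _ ≤ ENNReal.ofReal |c| * (2 * μ ({y | w y = 0} ∩ B)) := mul_le_mul' le_rfl hcover
          _ = 2 * (ENNReal.ofReal |c| * μ ({y | w y = 0} ∩ B)) := by ring
          _ ≤ _ := mul_le_mul' le_rfl hZ
    _ = 3 * I := by ring

end LocalPoincare

section Covering

variable {μ : Measure X} {Cd CP lam : ℝ} {u w : X → ℝ} {Ω : Set X} {k h : ℝ}

/-- A Poincaré inequality for the total variation of a nonnegative function that vanishes on at
least half of every ball of radius `r`. -/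
theorem MMS.setLIntegral_le_tv [BorelSpace X] (hX : MMS μ Cd CP lam) (x : X) {s s' r : ℝ} {n : ℕ}
    (hr : 0 < r) (hs : s + lam * r < s') (hn : 2 * (2 * lam + 1) ≤ 2 ^ n)
    (hw : AEMeasurable w (μ.restrict (ball x s'))) (hw0 : ∀ y, 0 ≤ w y)
    (hhalf : ∀ y ∈ closedBall x s, 2 * μ ({z | 0 < w z} ∩ ball y r) ≤ μ (ball y r)) :
    ∫⁻ y in closedBall x s, ENNReal.ofReal (w y) ∂μ ≤
      3 * (ENNReal.ofReal (CP * r) * (ENNReal.ofReal Cd ^ n * tv μ w (ball x s'))) := by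
  have := hX.properSpace
  have hconst : Continuous fun c : ℝ≥0∞ =>
      3 * (ENNReal.ofReal (CP * r) * (ENNReal.ofReal Cd ^ n * c)) := by
    have h1 : ENNReal.ofReal Cd ^ n ≠ ⊤ := ENNReal.pow_ne_top ENNReal.ofReal_ne_top
    exact (ENNReal.continuous_const_mul (by norm_num)).comp
      ((ENNReal.continuous_const_mul ENNReal.ofReal_ne_top).comp (ENNReal.continuous_const_mul h1))
  rcases eq_or_ne (tv μ w (ball x s')) ⊤ with htop | htop
  · rw [htop, ENNReal.mul_top, ENNReal.mul_top, ENNReal.mul_top]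
    · exact le_top
    · norm_num
    · have := mul_pos hX.hCP hr
      simpa using this
    · have := hX.hCd
      exact pow_ne_zero _ (by simpa using by linarith)
  have : (𝓝[>] (tv μ w (ball x s'))).NeBot := nhdsGT_neBot_of_exists_gt ⟨⊤, htop.lt_top⟩
  refine ge_of_tendsto ((hconst.tendsto _).mono_left
    (nhdsWithin_le_nhds (a := tv μ w (ball x s')) (s := Ioi (tv μ w (ball x s')))))
    (eventually_nhdsWithin_of_forall fun c hc => ?_)
  obtain ⟨v, g, hv, hvm, hvw, hg, hd, hgc⟩ := exists_seq_of_tv_lt isOpen_ball hc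
  obtain ⟨F, hFs, hFsep, hFcov⟩ := hX.exists_net x s hr
  have hsub : ∀ y ∈ F, closedBall y (lam * r) ⊆ ball x s' := fun y hy z hz => by
    have h1 : dist y x ≤ s := hFs y hy
    have h2 : dist z y ≤ lam * r := hz
    have h3 := dist_triangle z y x
    rw [mem_ball]
    linarith
  have hrr : r ≤ lam * r := le_mul_of_one_le_left hr.le hX.hlam
  have hsubr : ∀ y ∈ F, ball y r ⊆ closedBall y (lam * r) := fun y hy =>
    ball_subset_closedBall.trans (closedBall_subset_closedBall hrr)
  have hlim : Tendsto (fun i => 3 * ((∑ y ∈ F, ∫⁻ z in closedBall y (lam * r),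
      ENNReal.ofReal |v i z - w z| ∂μ) +
        ENNReal.ofReal (CP * r) * (ENNReal.ofReal Cd ^ n * c))) atTop
      (𝓝 (3 * (0 + ENNReal.ofReal (CP * r) * (ENNReal.ofReal Cd ^ n * c)))) := by
    refine ENNReal.Tendsto.const_mul (Tendsto.add ?_ tendsto_const_nhds) (Or.inr (by norm_num))
    have := tendsto_finsetSum F fun y hy =>
      hvw _ (isCompact_closedBall y (lam * r)) (hsub y hy)
    simpa using this
  rw [← zero_add (ENNReal.ofReal (CP * r) * (ENNReal.ofReal Cd ^ n * c))]
  refine ge_of_tendsto' hlim fun i => ?_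
  have hball : ∀ y ∈ F, ∫⁻ z in ball y r, ENNReal.ofReal (w z) ∂μ ≤
      3 * (∫⁻ z in closedBall y (lam * r), ENNReal.ofReal |v i z - w z| ∂μ +
        ENNReal.ofReal (CP * r) * ∫⁻ z in ball y (lam * r), g i z ∂μ) := by
    intro y hy
    obtain ⟨a, ha⟩ := hX.exists_lintegral_sub_le y hr (hv i) (hsub y hy) (hg i) (hd i)
    have hwB : AEMeasurable w (μ.restrict (ball y r)) :=
      hw.mono_measure (Measure.restrict_mono ((hsubr y hy).trans (hsub y hy)) le_rfl)
    refine (setLIntegral_le_three_mul (hX.measure_ball_lt_top y r).ne hwB hw0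
      (hhalf y (hFs y hy)) a).trans (mul_le_mul' le_rfl ?_)
    have hvB : AEMeasurable (v i) (μ.restrict (ball y r)) :=
      (hvm i).aemeasurable
    calc ∫⁻ z in ball y r, ENNReal.ofReal |w z - a| ∂μ
        ≤ ∫⁻ z in ball y r, (ENNReal.ofReal |v i z - w z| + ENNReal.ofReal |v i z - a|) ∂μ := by
          refine lintegral_mono fun z => ?_
          rw [← ENNReal.ofReal_add (abs_nonneg _) (abs_nonneg _)]
          refine ENNReal.ofReal_le_ofReal ?_
          rw [abs_sub_comm (v i z) (w z)]
          exact abs_sub_le _ _ _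
      _ = ∫⁻ z in ball y r, ENNReal.ofReal |v i z - w z| ∂μ +
            ∫⁻ z in ball y r, ENNReal.ofReal |v i z - a| ∂μ :=
          lintegral_add_left' (hvB.sub hwB).abs.ennreal_ofReal _
      _ ≤ _ := add_le_add (lintegral_mono_set (hsubr y hy)) ha
  calc ∫⁻ y in closedBall x s, ENNReal.ofReal (w y) ∂μ
      ≤ ∫⁻ y in ⋃ y ∈ F, ball y r, ENNReal.ofReal (w y) ∂μ := lintegral_mono_set hFcov
    _ ≤ ∑ y ∈ F, ∫⁻ z in ball y r, ENNReal.ofReal (w z) ∂μ := by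
        rw [← iUnion_subtype (· ∈ F) fun y => ball (y : X) r, ← Finset.sum_coe_sort F,
          ← tsum_fintype (L := .unconditional _)]
        exact lintegral_iUnion_le _ _
    _ ≤ ∑ y ∈ F, 3 * (∫⁻ z in closedBall y (lam * r), ENNReal.ofReal |v i z - w z| ∂μ +
        ENNReal.ofReal (CP * r) * ∫⁻ z in ball y (lam * r), g i z ∂μ) := Finset.sum_le_sum hball
    _ = 3 * (∑ y ∈ F, ∫⁻ z in closedBall y (lam * r), ENNReal.ofReal |v i z - w z| ∂μ +
        ENNReal.ofReal (CP * r) * ∑ y ∈ F, ∫⁻ z in ball y (lam * r), g i z ∂μ) := by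
        rw [← Finset.mul_sum, Finset.sum_add_distrib, Finset.mul_sum F]
    _ ≤ _ := by
        refine mul_le_mul' le_rfl (add_le_add le_rfl (mul_le_mul' le_rfl ?_))
        calc ∑ y ∈ F, ∫⁻ z in ball y (lam * r), g i z ∂μ
            = ∑ y ∈ F, ∫⁻ z in ball x s', (ball y (lam * r)).indicator (g i) z ∂μ := by
              refine Finset.sum_congr rfl fun y hy => ?_
              rw [lintegral_indicator measurableSet_ball, Measure.restrict_restrict
                measurableSet_ball, inter_eq_left.2 (ball_subset_closedBall.trans (hsub y hy))]
          _ = ∫⁻ z in ball x s', ∑ y ∈ F, (ball y (lam * r)).indicator (g i) z ∂μ :=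
              (lintegral_finsetSum _ fun y _ => (hg i).indicator measurableSet_ball).symm
          _ ≤ ∫⁻ z in ball x s', ENNReal.ofReal Cd ^ n * g i z ∂μ :=
              lintegral_mono fun z => hX.sum_indicator_ball_le hn hr F hFsep (g i) z
          _ = ENNReal.ofReal Cd ^ n * ∫⁻ z in ball x s', g i z ∂μ :=
              lintegral_const_mul _ (hg i)
          _ ≤ _ := mul_le_mul' le_rfl (hgc i).le

/-- A decay estimate for the measure of a sublevel set of a superminimizer that occupies at most
half of every ball of radius `r`. -/
theorem IsSuperminimizer.measure_lt_inter_closedBall_le [BorelSpace X] (hX : MMS μ Cd CP lam)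
    (hu : IsSuperminimizer μ u Ω) (x : X) {s s' r : ℝ} {n : ℕ} (hr : 0 < r)
    (hs : 2 * (lam * r) < s' - s) (hn : 2 * (2 * lam + 1) ≤ 2 ^ n) (hsub : closedBall x s' ⊆ Ω)
    (hhalf : ∀ y ∈ closedBall x s, 2 * μ ({z | u z < k} ∩ ball y r) ≤ μ (ball y r)) :
    μ ({z | u z < k} ∩ closedBall x s) ≤
      ENNReal.ofReal (6 * CP * Cd ^ n * (r / (s' - s))) *
        μ ({z | u z < k} ∩ closedBall x s') := by
  have := hX.properSpace
  have := hX.isLocallyFiniteMeasure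
  have hlam := hX.hlam
  have hCP := hX.hCP
  have hCd := hX.hCd
  have hlr : 0 < lam * r := by positivity
  obtain ⟨U, hU, hKU, hUΩ, huU⟩ := hu.1 _ (isCompact_closedBall x s') hsub
  have hum : ∀ A : Set X, A ⊆ closedBall x s' → AEMeasurable u (μ.restrict A) := fun A hA =>
    (huU.1.mono_set (hA.trans hKU)).aemeasurable
  set E := {z | u z < k} with hE
  have key : ∀ h : ℝ, 0 < h → μ ({z | u z ≤ k - h} ∩ closedBall x s) ≤
      ENNReal.ofReal (6 * CP * Cd ^ n * (r / (s' - s))) * μ (E ∩ closedBall x s') := by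
    intro h hh
    have hpos : {z | 0 < trunc k h (u z)} = E := by
      ext z
      simp [hE, trunc, hh]
    have hlow : ENNReal.ofReal h * μ ({z | u z ≤ k - h} ∩ closedBall x s) ≤
        ∫⁻ y in closedBall x s, ENNReal.ofReal (trunc k h (u y)) ∂μ := by
      refine le_trans ?_ (mul_meas_ge_le_lintegral₀
        (((continuous_trunc k h).measurable.comp_aemeasurable
          (hum _ (closedBall_subset_closedBall (by linarith)))).ennreal_ofReal)
        (ENNReal.ofReal h))
      refine mul_le_mul' le_rfl (le_trans (measure_mono (inter_subset_inter_left _ ?_))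
        (Measure.le_restrict_apply _ _))
      intro y (hy : u y ≤ k - h)
      exact ENNReal.ofReal_le_ofReal (le_max_of_le_right (le_min (by linarith) le_rfl))
    have hup : ∫⁻ y in closedBall x s', ENNReal.ofReal (trunc k h (u y)) ∂μ ≤
        ENNReal.ofReal h * μ (E ∩ closedBall x s') := by
      rw [← Measure.restrict_apply' measurableSet_closedBall]
      refine (lintegral_mono fun y => ?_).trans (lintegral_indicator_const_le E _)
      by_cases hy : y ∈ E
      · simpa [hy] using ENNReal.ofReal_le_ofReal (trunc_le hh.le (u y))
      · have : ¬ 0 < trunc k h (u y) := fun h0 => hy (hpos ▸ h0)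
        simpa [hy] using this
    have hmid := hX.setLIntegral_le_tv (w := fun y => trunc k h (u y)) x (s := s)
      (s' := (s + s') / 2) hr (by linarith) hn
      ((continuous_trunc k h).measurable.comp_aemeasurable (hum _
        (ball_subset_closedBall.trans (closedBall_subset_closedBall (by linarith)))))
      (fun y => trunc_nonneg k h (u y)) (by rwa [hpos])
    have htv := hu.tv_trunc_le (k := k) (s := (s + s') / 2) (by linarith) hsub hh.le
    refine (ENNReal.mul_le_mul_iff_right (a := ENNReal.ofReal h) (by simpa using hh)
      ENNReal.ofReal_ne_top).1 ?_
    calc _ ≤ _ := hlow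
      _ ≤ _ := hmid
      _ ≤ 3 * (ENNReal.ofReal (CP * r) * (ENNReal.ofReal Cd ^ n *
          (ENNReal.ofReal (1 / (s' - (s + s') / 2)) *
            (ENNReal.ofReal h * μ (E ∩ closedBall x s'))))) := by
        gcongr
        exact htv.trans (mul_le_mul' le_rfl hup)
      _ = ENNReal.ofReal h * (ENNReal.ofReal (3 * ((CP * r) * (Cd ^ n *
            (1 / (s' - (s + s') / 2))))) * μ (E ∩ closedBall x s')) := by
        have h1 : 0 < s' - (s + s') / 2 := by linarith
        have h2 : 0 ≤ CP * r := by positivity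
        rw [ENNReal.ofReal_mul (p := 3) (by norm_num), ENNReal.ofReal_mul (p := CP * r) h2,
          ENNReal.ofReal_mul (p := Cd ^ n) (by positivity), ENNReal.ofReal_pow (by positivity),
          ENNReal.ofReal_ofNat]
        ring
      _ = _ := by
        congr 3
        have h1 : s' - s ≠ 0 := by linarith
        have h2 : s' - (s + s') / 2 = (s' - s) / 2 := by ring
        rw [h2]
        field_simp
        norm_num
  have hunion : E ∩ closedBall x s =
      ⋃ i : ℕ, {z | u z ≤ k - 1 / ((i : ℝ) + 1)} ∩ closedBall x s := by
    rw [← iUnion_inter]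
    congr 1
    ext z
    simp only [hE, mem_ofPred_eq, mem_iUnion]
    refine ⟨fun hz => ?_, fun ⟨i, hi⟩ => ?_⟩
    · obtain ⟨i, hi⟩ := exists_nat_one_div_lt (sub_pos.2 hz)
      exact ⟨i, by linarith⟩
    · have : 0 < 1 / ((i : ℝ) + 1) := Nat.one_div_pos_of_nat
      linarith
  have hmono : Monotone fun i : ℕ => {z | u z ≤ k - 1 / ((i : ℝ) + 1)} ∩ closedBall x s := by
    refine fun i j hij z hz => ⟨?_, hz.2⟩
    have h1 : u z ≤ k - 1 / ((i : ℝ) + 1) := hz.1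
    have h2 : 1 / ((j : ℝ) + 1) ≤ 1 / ((i : ℝ) + 1) := Nat.one_div_le_one_div hij
    exact h1.trans (by linarith)
  rw [hunion, hmono.measure_iUnion]
  exact iSup_le fun i => key _ Nat.one_div_pos_of_nat

end Covering

section Decay

variable {μ : Measure X} {Cd CP lam : ℝ} {u : X → ℝ} {Ω : Set X}

theorem MMS.mono_doubling (hX : MMS μ Cd CP lam) {Cd' : ℝ} (h : Cd ≤ Cd') :
    MMS μ Cd' CP lam :=
  { hX with
    hCd := hX.hCd.trans h
    doubling := fun x r hr =>
      ⟨(hX.doubling x r hr).1, (hX.doubling x r hr).2.1.trans (by gcongr),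
        (hX.doubling x r hr).2.2⟩ }

theorem IsSuperminimizer.measure_lt_inter_closedBall_half_eq_zero [BorelSpace X]
    (hX : MMS μ Cd CP lam) (hCd : 2 ≤ Cd) (hu : IsSuperminimizer μ u Ω) {x : X} {R k : ℝ}
    {n m : ℕ} (hR : 0 < R) (hn : 2 * (2 * lam + 1) ≤ 2 ^ n) (hm : 8 * lam < 2 ^ m)
    (hm' : Cd * (6 * CP * Cd ^ n * (4 / 2 ^ m)) ≤ 1) (hsub : closedBall x R ⊆ Ω)
    (hsmall : 2 * ENNReal.ofReal Cd ^ (m + 1) * μ ({z | u z < k} ∩ closedBall x R) ≤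
      μ (ball x R)) :
    μ ({z | u z < k} ∩ closedBall x (R / 2)) = 0 := by
  set E := {z | u z < k}
  set C := ENNReal.ofReal Cd with hC
  have hCP := hX.hCP
  have hlam := hX.hlam
  have hC0 : C ≠ 0 := by simpa [hC] using by linarith
  have hCtop : C ≠ ⊤ := ENNReal.ofReal_ne_top
  set ρ : ℕ → ℝ := fun j => R / 2 * (1 + 1 / 2 ^ j) with hρ
  have hρR : ∀ j, ρ j ≤ R := fun j => by
    have : (1 : ℝ) / 2 ^ j ≤ 1 := by
      rw [div_le_one (by positivity)]
      exact one_le_pow₀ one_le_two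
    simp only [hρ]
    nlinarith
  have hρ2 : ∀ j, R / 2 ≤ ρ j := fun j => by
    have : (0 : ℝ) < 1 / 2 ^ j := by positivity
    simp only [hρ]
    nlinarith
  have hstep : ∀ j, ρ j - ρ (j + 1) = R / 2 ^ j / 4 := fun j => by
    simp only [hρ, pow_succ]
    field_simp
    ring
  have hinv : ∀ j, 2 * C ^ (j + (m + 1)) * μ (E ∩ closedBall x (ρ j)) ≤ μ (ball x R) := by
    intro j
    induction j with
    | zero => simpa [hρ, one_add_one_eq_two] using hsmall
    | succ j ih =>
      set r := R / 2 ^ j / 2 ^ m with hr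
      have hr0 : 0 < r := by positivity
      have hlr : 2 * (lam * r) < ρ j - ρ (j + 1) := by
        rw [hstep, hr, ← mul_assoc, mul_div_assoc', div_lt_div_iff₀ (by positivity) (by norm_num)]
        have : 0 < R / 2 ^ j := by positivity
        nlinarith
      have hrr : r ≤ lam * r := le_mul_of_one_le_left hr0.le hlam
      have hhalf : ∀ y ∈ closedBall x (ρ (j + 1)), 2 * μ (E ∩ ball y r) ≤ μ (ball y r) := by
        intro y hy
        rw [mem_closedBall] at hy
        refine (ENNReal.mul_le_mul_iff_right (a := C ^ (j + (m + 1))) (pow_ne_zero _ hC0)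
          (ENNReal.pow_ne_top hCtop)).1 ?_
        calc C ^ (j + (m + 1)) * (2 * μ (E ∩ ball y r))
            = 2 * C ^ (j + (m + 1)) * μ (E ∩ ball y r) := by ring
          _ ≤ 2 * C ^ (j + (m + 1)) * μ (E ∩ closedBall x (ρ j)) := by
            refine mul_le_mul' le_rfl (measure_mono (inter_subset_inter_right _ ?_))
            refine ball_subset_closedBall.trans (closedBall_subset_closedBall' ?_)
            linarith
          _ ≤ μ (ball x R) := ih
          _ ≤ μ (ball y (2 ^ (j + (m + 1)) * r)) := by
            refine measure_mono (ball_subset_ball' ?_)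
            have h1 : 2 ^ (j + (m + 1)) * r = 2 * R := by
              rw [hr, pow_add, pow_succ]
              field_simp
            rw [h1, dist_comm]
            linarith [hρR (j + 1)]
          _ ≤ C ^ (j + (m + 1)) * μ (ball y r) := hX.measure_ball_two_pow_mul_le y hr0 _
      have hdecay := hu.measure_lt_inter_closedBall_le hX x hr0 hlr hn
        ((closedBall_subset_closedBall (hρR j)).trans hsub) hhalf
      have hratio : r / (ρ j - ρ (j + 1)) = 4 / 2 ^ m := by
        rw [hstep, hr]
        field_simp
      rw [hratio] at hdecay
      calc 2 * C ^ (j + 1 + (m + 1)) * μ (E ∩ closedBall x (ρ (j + 1)))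
          ≤ 2 * C ^ (j + 1 + (m + 1)) * (ENNReal.ofReal (6 * CP * Cd ^ n * (4 / 2 ^ m)) *
              μ (E ∩ closedBall x (ρ j))) := mul_le_mul' le_rfl hdecay
        _ = C * ENNReal.ofReal (6 * CP * Cd ^ n * (4 / 2 ^ m)) *
              (2 * C ^ (j + (m + 1)) * μ (E ∩ closedBall x (ρ j))) := by ring
        _ ≤ 1 * μ (ball x R) := by
          refine mul_le_mul' ?_ ih
          rw [hC, ← ENNReal.ofReal_mul (by linarith)]
          exact ENNReal.ofReal_le_one.2 hm'
        _ = μ (ball x R) := one_mul _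
  by_contra h0
  obtain ⟨N, hN⟩ := ENNReal.exists_nat_mul_gt h0 (hX.measure_ball_lt_top x R).ne
  refine (hN.trans_le ?_).not_ge (hinv N)
  refine mul_le_mul' ?_ (measure_mono (inter_subset_inter_right _
    (closedBall_subset_closedBall (hρ2 N))))
  have h2C : (2 : ℝ≥0∞) ≤ C := by
    rw [hC, ← ENNReal.ofReal_ofNat]
    exact ENNReal.ofReal_le_ofReal hCd
  calc (N : ℝ≥0∞) ≤ 2 ^ N := by exact_mod_cast Nat.lt_two_pow_self.le
    _ ≤ C ^ N := by gcongr
    _ ≤ C ^ (N + (m + 1)) := pow_le_pow_right₀ (one_le_two.trans h2C) (by omega)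
    _ ≤ 2 * C ^ (N + (m + 1)) := le_mul_of_one_le_left zero_le one_le_two

/-- A sublevel set of a superminimizer that is small in measure in a ball is null in the
concentric ball of half the radius. -/
theorem MMS.exists_measure_lt_inter_closedBall_half_eq_zero [BorelSpace X]
    (hX : MMS μ Cd CP lam) : ∃ M : ℝ≥0∞, M ≠ 0 ∧ M ≠ ⊤ ∧
      ∀ (Ω : Set X) (u : X → ℝ), IsSuperminimizer μ u Ω → ∀ (x : X) (R k : ℝ), 0 < R →
        closedBall x R ⊆ Ω → M * μ ({z | u z < k} ∩ closedBall x R) ≤ μ (ball x R) →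
          μ ({z | u z < k} ∩ closedBall x (R / 2)) = 0 := by
  have hCP := hX.hCP
  set D := max 2 Cd
  have hX' : MMS μ D CP lam := hX.mono_doubling (le_max_right _ _)
  have hD : 2 ≤ D := le_max_left _ _
  obtain ⟨n, hn⟩ := pow_unbounded_of_one_lt (2 * (2 * lam + 1)) (one_lt_two : (1 : ℝ) < 2)
  obtain ⟨m, hm⟩ := pow_unbounded_of_one_lt (max (8 * lam) (D * (6 * CP * D ^ n * 4)))
    (one_lt_two : (1 : ℝ) < 2)
  rw [max_lt_iff] at hm
  refine ⟨2 * ENNReal.ofReal D ^ (m + 1), ?_,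
    ENNReal.mul_ne_top (by norm_num) (ENNReal.pow_ne_top ENNReal.ofReal_ne_top),
    fun Ω u hu x R k hR hsub hsmall => hu.measure_lt_inter_closedBall_half_eq_zero hX' hD hR hn.le
      hm.1 ?_ hsub hsmall⟩
  · refine mul_ne_zero (by norm_num) (pow_ne_zero _ ?_)
    simpa using by linarith
  · rw [mul_div_assoc', mul_div_assoc', div_le_one (by positivity)]
    exact hm.2.le

theorem le_lowerApprox_of_measure_eq_zero {x z : X} {r t : ℝ}
    (h : μ ({y | u y < t} ∩ closedBall x r) = 0) (hz : z ∈ ball x r) :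
    (t : EReal) ≤ lowerApprox μ u z := by
  refine le_sSup ⟨t, ?_, rfl⟩
  refine tendsto_const_nhds.congr' ?_
  obtain ⟨ε, hε, hsub⟩ := Metric.isOpen_iff.1 isOpen_ball z hz
  filter_upwards [Ioo_mem_nhdsGT hε] with s hs
  have : μ ({y | u y < t} ∩ ball z s) = 0 := measure_mono_null (inter_subset_inter_right _
    ((ball_subset_ball hs.2.le).trans (hsub.trans ball_subset_closedBall))) h
  simp [this]

theorem exists_closedBall_subset (hΩ : IsOpen Ω) {x : X} (hx : x ∈ Ω) :
    ∃ ε > 0, ∀ R, R < ε → closedBall x R ⊆ Ω := by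
  obtain ⟨ε, hε, hsub⟩ := Metric.isOpen_iff.1 hΩ x hx
  exact ⟨ε, hε, fun R hR => (closedBall_subset_ball hR).trans hsub⟩

theorem IsSuperminimizer.bot_lt_lowerApprox [BorelSpace X] (hX : MMS μ Cd CP lam)
    (hΩ : IsOpen Ω) (hu : IsSuperminimizer μ u Ω) {x : X} (hx : x ∈ Ω) :
    ⊥ < lowerApprox μ u x := by
  have := hX.properSpace
  obtain ⟨M, hM0, hM, hnull⟩ := hX.exists_measure_lt_inter_closedBall_half_eq_zero
  obtain ⟨ε, hε, hsub⟩ := exists_closedBall_subset hΩ hx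
  set R := ε / 2
  have hR : 0 < R := half_pos hε
  have hRΩ : closedBall x R ⊆ Ω := hsub R (half_lt_self hε)
  obtain ⟨U, -, hKU, -, huU⟩ := hu.1 _ (isCompact_closedBall x R) hRΩ
  have hint : IntegrableOn u (closedBall x R) μ := huU.1.mono_set hKU
  set J := ∫⁻ y in closedBall x R, ENNReal.ofReal |u y| ∂μ
  have hJ : J ≠ ⊤ := by
    have := hint.hasFiniteIntegral
    rw [hasFiniteIntegral_iff_norm] at this
    exact this.ne
  obtain ⟨i, hi⟩ := ENNReal.exists_nat_mul_gt (hX.measure_ball_pos x hR).ne'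
    (ENNReal.mul_ne_top hM hJ)
  have hi0 : (i : ℝ≥0∞) ≠ 0 := fun h => by simp [h] at hi
  have hmark : (i : ℝ≥0∞) * μ ({z | u z < -(i : ℝ)} ∩ closedBall x R) ≤ J := by
    refine le_trans ?_ (mul_meas_ge_le_lintegral₀ hint.aemeasurable.abs.ennreal_ofReal (i : ℝ≥0∞))
    refine mul_le_mul' le_rfl (le_trans (measure_mono (inter_subset_inter_left _ ?_))
      (Measure.le_restrict_apply _ _))
    intro y (hy : u y < -(i : ℝ))
    show (i : ℝ≥0∞) ≤ ENNReal.ofReal |u y|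
    rw [← ENNReal.ofReal_natCast]
    exact ENNReal.ofReal_le_ofReal (by linarith [neg_le_abs (u y)])
  refine (EReal.bot_lt_coe (-(i : ℝ))).trans_le (le_lowerApprox_of_measure_eq_zero
    (hnull Ω u hu x R _ hR hRΩ ?_) (mem_ball_self (half_pos hR)))
  refine (ENNReal.mul_le_mul_iff_right hi0 (ENNReal.natCast_ne_top i)).1 ?_
  calc _ = M * ((i : ℝ≥0∞) * μ ({z | u z < -(i : ℝ)} ∩ closedBall x R)) := by ring
    _ ≤ M * J := mul_le_mul' le_rfl hmark
    _ ≤ _ := hi.le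

theorem IsSuperminimizer.eventually_lt_lowerApprox [BorelSpace X] (hX : MMS μ Cd CP lam)
    (hΩ : IsOpen Ω) (hu : IsSuperminimizer μ u Ω) {x : X} (hx : x ∈ Ω) {a : EReal}
    (ha : a < lowerApprox μ u x) : ∀ᶠ z in 𝓝 x, a < lowerApprox μ u z := by
  obtain ⟨M, hM0, hM, hnull⟩ := hX.exists_measure_lt_inter_closedBall_half_eq_zero
  obtain ⟨ε, hε, hsub⟩ := exists_closedBall_subset hΩ hx
  obtain ⟨_, ⟨t, ht, rfl⟩, hat⟩ := lt_sSup_iff.1 ha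
  have hC : ENNReal.ofReal Cd ≠ 0 := by
    have := hX.hCd
    simpa using by linarith
  have hMC : 0 < (M * ENNReal.ofReal Cd)⁻¹ :=
    ENNReal.inv_pos.2 (ENNReal.mul_ne_top hM ENNReal.ofReal_ne_top)
  obtain ⟨r, hr, hr0⟩ := ((ht.eventually_lt_const hMC).and (Ioo_mem_nhdsGT hε)).exists
  have hR : 0 < r / 2 := half_pos hr0.1
  have hsmall : M * μ ({z | u z < t} ∩ closedBall x (r / 2)) ≤ μ (ball x (r / 2)) := by
    have h1 : μ ({z | u z < t} ∩ closedBall x (r / 2)) ≤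
        (M * ENNReal.ofReal Cd)⁻¹ * μ (ball x r) := by
      refine (measure_mono (inter_subset_inter_right _
        (closedBall_subset_ball (half_lt_self hr0.1)))).trans ?_
      exact (ENNReal.div_le_iff (hX.measure_ball_pos x hr0.1).ne'
        (hX.measure_ball_lt_top x r).ne).1 hr.le
    have h2 : μ (ball x r) ≤ ENNReal.ofReal Cd * μ (ball x (r / 2)) := by
      simpa [mul_div_cancel₀] using (hX.doubling x (r / 2) hR).2.1
    calc _ ≤ M * ((M * ENNReal.ofReal Cd)⁻¹ * (ENNReal.ofReal Cd * μ (ball x (r / 2)))) :=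
          mul_le_mul' le_rfl (h1.trans (mul_le_mul' le_rfl h2))
      _ = (M * ENNReal.ofReal Cd) * (M * ENNReal.ofReal Cd)⁻¹ * μ (ball x (r / 2)) := by ring
      _ = _ := by
        rw [ENNReal.mul_inv_cancel (mul_ne_zero hM0 hC)
          (ENNReal.mul_ne_top hM ENNReal.ofReal_ne_top), one_mul]
  have h0 := hnull Ω u hu x (r / 2) t hR (hsub _ ((half_lt_self hr0.1).trans hr0.2)) hsmall
  filter_upwards [ball_mem_nhds x (half_pos hR)] with z hz
  exact hat.trans_le (le_lowerApprox_of_measure_eq_zero h0 hz)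

end Decay

/-- **Lower semicontinuity of 1-superminimizers.** If `u` is a 1-superminimizer in an open set
`Ω`, then `u^∧` takes values in `(-∞,∞]` on `Ω` and is lower semicontinuous on `Ω`. -/
theorem superminimizer_lowerApprox_lsc
    {X : Type*} [MetricSpace X] [MeasurableSpace X] [BorelSpace X]
    (μ : Measure X) (Cd CP lam : ℝ) (hX : MMS μ Cd CP lam)
    (Ω : Set X) (hΩopen : IsOpen Ω) (u : X → ℝ)
    (hu : IsSuperminimizer μ u Ω) :
    (∀ x ∈ Ω, (⊥ : EReal) < lowerApprox μ u x) ∧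
      LowerSemicontinuousOn (lowerApprox μ u) Ω := by
  exact ⟨fun x hx => hu.bot_lt_lowerApprox hX hΩopen hx, fun x hx a ha =>
    eventually_nhdsWithin_of_eventually_nhds (hu.eventually_lt_lowerApprox hX hΩopen hx ha)⟩

end MetricBV
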